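/- arXiv:1110.1249 — 3 statements merged into one kernel-verified Lean document; each statement's English description precedes it below -/
import Mathlib

section
/- Let k ≥ 3, r ≥ 2, ω ≥ 1 be integers and b, α be positive reals. Set t = ⌊√(ln k / ln(α ln k))⌋ and q = (α ln k)/k. Let H = (V,E) be a k-uniform 2-simple hypergraph such that every edge of H is contained in at most ω 3-cycles and every edge of H intersects at most d other edges of H, where d ≤ r^{k−1} k^{1−b/t} − 1. If b ≤ t < k − ω, 2/k ≤ q ≤ 1/2, and k²/2^k + (t+1)·k^{1−α}·e^{α(ln k)(t+ω)/k}·(α ln k)^{t+ω} + ((t+1)²/t!)·k^{2−b}·(α ln k)^{tω} + (t+1)·t·(2eα ln k/(t−1))^{t−1}·k^{1+α−b} < 1/4, then χ(H) ≤ r. -/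
open Finset Filter

open scoped Classical

namespace HG

/-- A finset `e` is monochromatic under the coloring `c`. -/
def Monochromatic {V α : Type*} (c : V → α) (e : Finset V) : Prop :=
  ∀ v ∈ e, ∀ w ∈ e, c v = c w

/-- The hypergraph with edge set `E` admits a proper coloring with `r` colors. -/
def RColorable {V : Type*} (r : ℕ) (E : Finset (Finset V)) : Prop :=
  ∃ c : V → Fin r, ∀ e ∈ E, ¬ Monochromatic c e

/-- The hypergraph with edge set `E` is `r`-choosable: for every assignment of
color lists of size `r` there is a proper coloring from the lists. -/
def RChoosable {V : Type*} (r : ℕ) (E : Finset (Finset V)) : Prop :=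
  ∀ L : V → Finset ℕ, (∀ v, (L v).card = r) →
    ∃ c : V → ℕ, (∀ v, c v ∈ L v) ∧ ∀ e ∈ E, ¬ Monochromatic c e

/-- Probability that the binomial random hypergraph `H(n,k,p)` (each of the
`C(n,k)` possible `k`-element edges present independently with probability `p`)
satisfies the property `P` of its edge set. -/
noncomputable def hyperProb (n k : ℕ) (p : ℝ)
    (P : Finset (Finset (Fin n)) → Prop) : ℝ :=
  ∑ E ∈ ((Finset.univ : Finset (Fin n)).powersetCard k).powerset,
    if P E then
      p ^ E.card *
        (1 - p) ^ (((Finset.univ : Finset (Fin n)).powersetCard k).card - E.card)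
    else 0

/-- Maximum vertex degree of the hypergraph with edge set `E`. -/
def maxDegree {V : Type*} [DecidableEq V] (E : Finset (Finset V)) : ℕ :=
  (E.biUnion id).sup fun v => (E.filter fun e => v ∈ e).card

/-- Three distinct edges forming a 3-cycle (triangle). -/
def IsTriangle {V : Type*} [DecidableEq V] (e f h : Finset V) : Prop :=
  e ≠ f ∧ e ≠ h ∧ f ≠ h ∧ ((e ∩ f) \ h).Nonempty ∧ ((e ∩ h) \ f).Nonempty ∧
    ((f ∩ h) \ e).Nonempty

/-- A hypergraph is 2-simple if any two distinct edges share at most 2 vertices. -/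
def TwoSimple {V : Type*} [DecidableEq V] (E : Finset (Finset V)) : Prop :=
  ∀ e ∈ E, ∀ f ∈ E, e ≠ f → (e ∩ f).card ≤ 2

/-- The number of 3-cycles of the hypergraph `E` containing the edge `e`. -/
noncomputable def triCount {V : Type*} [DecidableEq V]
    (E : Finset (Finset V)) (e : Finset V) : ℕ :=
  ((E.powersetCard 2).filter fun s =>
    ∃ f ∈ s, ∃ h ∈ s, f ≠ h ∧ IsTriangle e f h).card

/-- The function `φ(k) = 4⌊√(ln k / ln (2 ln k))⌋⁻¹`. -/
noncomputable def phi (k : ℕ) : ℝ :=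
  4 * ((⌊Real.sqrt (Real.log k / Real.log (2 * Real.log k))⌋₊ : ℝ))⁻¹

end HG

namespace HG

open MeasureTheory ProbabilityTheory

section ProductSpace

variable {V St : Type*}

/-- The event `A` is determined by the coordinates in `T`. -/
def DeterminedBy (A : Set (V → St)) (T : Finset V) : Prop :=
  ∀ x y : V → St, (∀ v ∈ T, x v = y v) → x ∈ A → y ∈ A

lemma DeterminedBy.eq_preimage {A : Set (V → St)} {T : Finset V} (h : DeterminedBy A T) :
    A = T.restrict ⁻¹' (T.restrict '' A) := by
  refine Set.Subset.antisymm (Set.subset_preimage_image _ _) ?_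
  rintro y ⟨x, hx, hxy⟩
  exact h x y (fun v hv => congrFun hxy ⟨v, hv⟩) hx

variable [Finite St] [MeasurableSpace St] [MeasurableSingletonClass St]
  (ν : Measure St) [IsProbabilityMeasure ν]

lemma DeterminedBy.measurableSet {A : Set (V → St)} {T : Finset V} (h : DeterminedBy A T) :
    MeasurableSet A := by
  rw [h.eq_preimage]
  exact (Finset.measurable_restrict T) (Set.toFinite _).measurableSet

lemma real_inter_of_determinedBy {A B : Set (V → St)} {S T : Finset V}
    (hA : DeterminedBy A S) (hB : DeterminedBy B T) (hST : Disjoint S T) :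
    (Measure.infinitePi fun _ : V => ν).real (A ∩ B) =
      (Measure.infinitePi fun _ : V => ν).real A * (Measure.infinitePi fun _ : V => ν).real B := by
  have hind : iIndepFun (fun (v : V) (x : V → St) => x v) (Measure.infinitePi fun _ : V => ν) :=
    iIndepFun_infinitePi (X := fun _ s => s) fun _ => measurable_id
  have := (hind.indepFun_finset S T hST fun v => measurable_pi_apply v).measure_inter_preimage_eq_mul
    (S.restrict '' A) (T.restrict '' B) (Set.toFinite _).measurableSet
    (Set.toFinite _).measurableSet
  have hA' := hA.eq_preimage
  have hB' := hB.eq_preimage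
  simp only [Measure.real, ← ENNReal.toReal_mul]
  congr 1
  change _ = _ at this
  rwa [show (fun (x : V → St) (i : S) => x i) = S.restrict from rfl,
    show (fun (x : V → St) (i : T) => x i) = T.restrict from rfl, ← hA', ← hB'] at this

lemma integral_prod_coord (T : Finset V) (φ : V → St → ℝ) :
    ∫ x, ∏ v ∈ T, φ v (x v) ∂(Measure.infinitePi fun _ : V => ν) =
      ∏ v ∈ T, ∫ s, φ v s ∂ν := by
  have hind : iIndepFun (fun (v : V) (x : V → St) => x v) (Measure.infinitePi fun _ : V => ν) :=
    iIndepFun_infinitePi (X := fun _ s => s) fun _ => measurable_id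
  have hind' := hind.precomp (g := fun v : T => (v : V)) Subtype.val_injective
  have h := hind'.integral_fun_prod_comp (f := fun v : T => φ v)
    (fun v => (measurable_pi_apply (v : V)).aemeasurable)
    (fun v => (measurable_of_finite _).aestronglyMeasurable)
  simp only [← Finset.prod_coe_sort T]
  refine h.trans (Finset.prod_congr rfl fun v _ => ?_)
  conv_rhs => rw [← Measure.infinitePi_map_eval (fun _ : V => ν) (v : V)]
  rw [integral_map (measurable_pi_apply (v : V)).aemeasurable
    (measurable_of_finite _).aestronglyMeasurable]

/-- If the indicator of `A` is at most a constant multiple of a product of functions of single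
coordinates, then the probability of `A` is at most the same multiple of the product of the
expectations. -/
lemma real_le_of_le_prod {A : Set (V → St)} (T : Finset V) (hA : DeterminedBy A T) (C : ℝ)
    (φ : V → St → ℝ)
    (hφ : ∀ v s, 0 ≤ φ v s) (hC : 0 ≤ C) (hle : ∀ x ∈ A, 1 ≤ C * ∏ v ∈ T, φ v (x v)) :
    (Measure.infinitePi fun _ : V => ν).real A ≤ C * ∏ v ∈ T, ∫ s, φ v s ∂ν := by
  rw [← integral_prod_coord, ← integral_const_mul, ← integral_indicator_one hA.measurableSet]
  have hbd : ∃ M : ℝ, ∀ x : V → St, ‖C * ∏ v ∈ T, φ v (x v)‖ ≤ M := by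
    choose M hM using fun v => (Set.finite_range (φ v)).bddAbove
    refine ⟨C * ∏ v ∈ T, M v, fun x => ?_⟩
    rw [Real.norm_of_nonneg (mul_nonneg hC (Finset.prod_nonneg fun v _ => hφ v _))]
    gcongr with v _
    · exact fun v _ => hφ v _
    · exact hM v ⟨_, rfl⟩
  obtain ⟨M, hM⟩ := hbd
  apply integral_mono
  · exact (integrable_const 1).indicator hA.measurableSet
  · refine Integrable.of_bound (C := M) ?_ (Filter.Eventually.of_forall hM)
    refine Measurable.aestronglyMeasurable (Measurable.const_mul ?_ _)
    exact Finset.measurable_prod _ fun v _ =>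
      (measurable_of_finite (φ v)).comp (measurable_pi_apply v)
  · intro x
    by_cases hx : x ∈ A
    · simpa [hx] using hle x hx
    · simpa [hx] using mul_nonneg hC (Finset.prod_nonneg fun v _ => hφ v _)

end ProductSpace

section LocalLemma

variable {V St ι : Type*}

/-- Configurations avoiding every bad event supported inside the edge set `F`. -/
def avoiding (I : Finset ι) (supp : ι → Finset (Finset V)) (ev : ι → Set (V → St))
    (F : Finset (Finset V)) : Set (V → St) :=
  {x | ∀ i ∈ I, supp i ⊆ F → x ∉ ev i}

lemma avoiding_anti (I : Finset ι) (supp : ι → Finset (Finset V)) (ev : ι → Set (V → St))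
    {F G : Finset (Finset V)} (h : F ⊆ G) :
    avoiding I supp ev G ⊆ avoiding I supp ev F :=
  fun _ hx i hi hF => hx i hi (hF.trans h)

lemma determinedBy_avoiding [DecidableEq V] (I : Finset ι) (supp : ι → Finset (Finset V)) (ev : ι → Set (V → St))
    (hdet : ∀ i ∈ I, DeterminedBy (ev i) ((supp i).biUnion id)) (F : Finset (Finset V)) :
    DeterminedBy (avoiding I supp ev F) (F.biUnion id) := by
  intro x y hxy hx i hi hF hy
  refine hx i hi hF (hdet i hi y x (fun v hv => (hxy v ?_).symm) hy)
  exact Finset.biUnion_subset_biUnion_of_subset_left _ hF hv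

variable [DecidableEq V] [Finite St] [MeasurableSpace St] [MeasurableSingletonClass St]
  (ν : Measure St) [IsProbabilityMeasure ν]

/-- A local lemma in which dependencies are counted by edges of a hypergraph: if every edge meets
at most `N` edges and the bad events whose support contains a given edge have weighted total
probability at most `1 / (2N)`, then all bad events can be avoided. -/
theorem exists_avoiding (E : Finset (Finset V)) (I : Finset ι) (supp : ι → Finset (Finset V))
    (ev : ι → Set (V → St)) (N : ℕ) (hN : 0 < N)
    (hdet : ∀ i ∈ I, DeterminedBy (ev i) ((supp i).biUnion id))
    (hne : ∀ i ∈ I, (supp i).Nonempty)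
    (hsub : ∀ i ∈ I, supp i ⊆ E)
    (hdeg : ∀ e ∈ E, (E.filter fun f => (e ∩ f).Nonempty).card ≤ N)
    (hsum : ∀ e ∈ E, ∑ i ∈ I with e ∈ supp i,
      (Measure.infinitePi fun _ : V => ν).real (ev i) * 2 ^ (supp i).card ≤ 1 / (2 * N)) :
    ∃ x : V → St, ∀ i ∈ I, x ∉ ev i := by
  set μ := Measure.infinitePi fun _ : V => ν with hμ
  set G := avoiding I supp ev with hG
  set β : ℝ := 1 - 1 / (2 * N) with hβ
  have hN1 : (1 : ℝ) ≤ N := by exact_mod_cast hN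
  have hN2 : 1 / (2 * (N : ℝ)) ≤ 1 / 2 := by gcongr; linarith
  have hN0 : 0 ≤ 1 / (2 * (N : ℝ)) := by positivity
  have hβ0 : 0 < β := by rw [hβ]; linarith
  have hβ1 : β ≤ 1 := by rw [hβ]; linarith
  have hβN : 1 / 2 ≤ β ^ N := by
    have := one_add_mul_le_pow (a := -(1 / (2 * (N : ℝ)))) (by linarith) N
    have h2 : 1 + (N : ℝ) * -(1 / (2 * (N : ℝ))) = 1 / 2 := by field_simp; norm_num
    rw [h2] at this
    rwa [hβ, sub_eq_add_neg]
  have hGdet := determinedBy_avoiding I supp ev hdet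
  have key : ∀ F : Finset (Finset V), F ⊆ E → ∀ F' ⊆ F,
      μ.real (G F') * β ^ (F \ F').card ≤ μ.real (G F) := by
    intro F
    induction F using Finset.strongInduction with
    | H F ih =>
    intro hFE F' hF'
    rcases hF'.eq_or_ssubset with rfl | hss
    · simp
    obtain ⟨e, heF, heF'⟩ := Finset.exists_of_ssubset hss
    set F0 := F.erase e with hF0
    have hF0F : F0 ⊂ F := Finset.erase_ssubset heF
    have hF'F0 : F' ⊆ F0 := fun f hf =>
      Finset.mem_erase.2 ⟨fun h => heF' (h ▸ hf), hF' hf⟩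
    have ih0 := ih F0 hF0F (hF0F.1.trans hFE)
    have step : ∀ i ∈ I, e ∈ supp i → μ.real (ev i ∩ G F0) ≤
        μ.real (ev i) * 2 ^ (supp i).card * μ.real (G F0) := by
      intro i hi _
      set Fi := F0.filter fun f => ∀ h ∈ supp i, ¬ (h ∩ f).Nonempty with hFi
      have hFisub : Fi ⊆ F0 := Finset.filter_subset _ _
      have hdisj : Disjoint ((supp i).biUnion id) (Fi.biUnion id) := by
        rw [Finset.disjoint_left]
        intro v hv hv'
        simp only [Finset.mem_biUnion, id] at hv hv'
        obtain ⟨h, hh, hvh⟩ := hv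
        obtain ⟨f, hf, hvf⟩ := hv'
        exact (Finset.mem_filter.1 hf).2 h hh ⟨v, Finset.mem_inter.2 ⟨hvh, hvf⟩⟩
      have hcard : (F0 \ Fi).card ≤ N * (supp i).card := by
        calc (F0 \ Fi).card
            ≤ ((supp i).biUnion fun h => E.filter fun f => (h ∩ f).Nonempty).card := by
              apply Finset.card_le_card
              intro f hf
              rw [Finset.mem_sdiff, hFi, Finset.mem_filter] at hf
              obtain ⟨hf1, hf2⟩ := hf
              push Not at hf2
              obtain ⟨h, hh, hhf⟩ := hf2 hf1
              exact Finset.mem_biUnion.2 ⟨h, hh, Finset.mem_filter.2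
                ⟨hFE (hF0F.1 hf1), hhf⟩⟩
          _ ≤ (supp i).card * N := Finset.card_biUnion_le_card_mul _ _ _
              fun h hh => hdeg h (hsub i hi hh)
          _ = _ := mul_comm _ _
      have h1 : μ.real (ev i ∩ G F0) ≤ μ.real (ev i) * μ.real (G Fi) := by
        rw [hμ, ← real_inter_of_determinedBy ν (hdet i hi) (hGdet Fi) hdisj]
        exact measureReal_mono (Set.inter_subset_inter_right _ (avoiding_anti _ _ _ hFisub))
      have h2 := ih0 Fi hFisub
      have h3 : (1 / 2 : ℝ) ^ (supp i).card ≤ β ^ (F0 \ Fi).card := by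
        calc (1 / 2 : ℝ) ^ (supp i).card ≤ (β ^ N) ^ (supp i).card := by gcongr
          _ = β ^ (N * (supp i).card) := by rw [pow_mul]
          _ ≤ _ := pow_le_pow_of_le_one hβ0.le hβ1 hcard
      have h4 : μ.real (G Fi) ≤ 2 ^ (supp i).card * μ.real (G F0) := by
        have : μ.real (G Fi) * (1 / 2 : ℝ) ^ (supp i).card ≤ μ.real (G F0) :=
          (mul_le_mul_of_nonneg_left h3 measureReal_nonneg).trans h2
        rw [one_div, inv_pow, ← div_eq_mul_inv, div_le_iff₀ (by positivity)] at this
        linarith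
      calc _ ≤ _ := h1
        _ ≤ μ.real (ev i) * (2 ^ (supp i).card * μ.real (G F0)) := by gcongr
        _ = _ := by ring
    have hcover : G F0 ⊆ G F ∪ ⋃ i ∈ I.filter fun i => e ∈ supp i, ev i ∩ G F0 := by
      intro x hx
      by_cases hxF : x ∈ G F
      · exact Or.inl hxF
      right
      simp only [hG, avoiding, Set.mem_ofPred_eq] at hxF
      push Not at hxF
      obtain ⟨i, hi, hiF, hxi⟩ := hxF
      have hei : e ∈ supp i := by
        by_contra hei
        refine hx i hi (fun f hf => Finset.mem_erase.2 ⟨?_, hiF hf⟩) hxi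
        rintro rfl
        exact hei hf
      exact Set.mem_biUnion (Finset.mem_coe.2 (Finset.mem_filter.2 ⟨hi, hei⟩)) ⟨hxi, hx⟩
    have hmain : μ.real (G F0) ≤ μ.real (G F) + 1 / (2 * N) * μ.real (G F0) := by
      calc μ.real (G F0) ≤ _ := measureReal_mono hcover
        _ ≤ μ.real (G F) + μ.real (⋃ i ∈ I.filter fun i => e ∈ supp i, ev i ∩ G F0) :=
            measureReal_union_le _ _
        _ ≤ μ.real (G F) + ∑ i ∈ I with e ∈ supp i, μ.real (ev i ∩ G F0) := by
            gcongr
            exact measureReal_biUnion_finset_le _ _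
        _ ≤ μ.real (G F) + ∑ i ∈ I with e ∈ supp i,
              μ.real (ev i) * 2 ^ (supp i).card * μ.real (G F0) := by
            gcongr with i hi
            rw [Finset.mem_filter] at hi
            exact step i hi.1 hi.2
        _ ≤ _ := by
            rw [← Finset.sum_mul]
            gcongr
            exact hsum e (hFE heF)
    have hstep : μ.real (G F0) * β ≤ μ.real (G F) := by rw [hβ]; linarith
    have hcard : (F \ F').card = (F0 \ F').card + 1 := by
      rw [hF0, Finset.erase_sdiff_comm, Finset.card_erase_add_one]
      exact Finset.mem_sdiff.2 ⟨heF, heF'⟩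
    calc μ.real (G F') * β ^ (F \ F').card = μ.real (G F') * β ^ (F0 \ F').card * β := by
          rw [hcard, pow_succ]; ring
      _ ≤ μ.real (G F0) * β := by
          gcongr
          exact ih0 F' hF'F0
      _ ≤ _ := hstep
  have hE := key E Subset.rfl ∅ (Finset.empty_subset _)
  have h0 : G ∅ = Set.univ := by
    ext x
    simp only [hG, avoiding, Set.mem_ofPred_eq, Set.mem_univ, iff_true]
    intro i hi h
    exact absurd (hne i hi) (by rw [Finset.subset_empty.1 h]; simp)
  rw [h0, probReal_univ, one_mul] at hE
  have hpos : 0 < μ.real (G E) := lt_of_lt_of_le (by positivity) hE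
  obtain ⟨x, hx⟩ : (G E).Nonempty := by
    by_contra h
    rw [Set.not_nonempty_iff_eq_empty.1 h] at hpos
    simp at hpos
  exact ⟨x, fun i hi => hx i hi (hsub i hi)⟩

end LocalLemma

end HG

namespace HG

open MeasureTheory ProbabilityTheory

section RecolorMeasure

variable {r : ℕ} {q : ℝ}

/-- Weight of a vertex state `(c, g)`: the initial color `c` is uniform, and the vertex is
recolorable (that is, `g ≠ c`) with probability `q`, in which case `g` is uniform on the other
colors. -/
noncomputable def stateWeight (r : ℕ) (q : ℝ) (s : Fin r × Fin r) : ℝ :=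
  if s.1 = s.2 then (1 - q) / r else q / (r * (r - 1))

lemma stateWeight_nonneg (hr : 2 ≤ r) (h0 : 0 ≤ q) (h1 : q ≤ 1) (s : Fin r × Fin r) :
    0 ≤ stateWeight r q s := by
  have : (2 : ℝ) ≤ r := by exact_mod_cast hr
  unfold stateWeight
  split_ifs
  · exact div_nonneg (by linarith) (by linarith)
  · exact div_nonneg h0 (mul_nonneg (by linarith) (by linarith))

lemma sum_stateWeight_right (hr : 2 ≤ r) (c : Fin r) :
    ∑ g, stateWeight r q (c, g) = 1 / r := by
  have h2 : (2 : ℝ) ≤ r := by exact_mod_cast hr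
  have h : ∀ g, stateWeight r q (c, g) =
      q / (r * (r - 1)) + if c = g then (1 - q) / r - q / (r * (r - 1)) else 0 := by
    intro g
    unfold stateWeight
    split_ifs <;> simp
  rw [Finset.sum_congr rfl fun g _ => h g, Finset.sum_add_distrib, Finset.sum_ite_eq]
  have h3 : (r : ℝ) - 1 ≠ 0 := by linarith
  have h4 : (r : ℝ) ≠ 0 := by linarith
  simp
  field_simp
  ring

lemma stateWeight_swap (s : Fin r × Fin r) : stateWeight r q s.swap = stateWeight r q s := by
  simp [stateWeight, eq_comm]

lemma sum_stateWeight_left (hr : 2 ≤ r) (g : Fin r) :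
    ∑ c, stateWeight r q (c, g) = 1 / r := by
  rw [← sum_stateWeight_right (q := q) hr g]
  exact Finset.sum_congr rfl fun c _ => stateWeight_swap (g, c)

lemma exists_stateMeasure (hr : 2 ≤ r) (h0 : 0 ≤ q) (h1 : q ≤ 1) :
    ∃ ν : Measure (Fin r × Fin r), IsProbabilityMeasure ν ∧
      ∀ φ : Fin r × Fin r → ℝ, ∫ s, φ s ∂ν = ∑ s, stateWeight r q s * φ s := by
  have hr0 : (r : ℝ) ≠ 0 := by positivity
  have hsum : ∑ s, ENNReal.ofReal (stateWeight r q s) = 1 := by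
    rw [← ENNReal.ofReal_sum_of_nonneg fun s _ => stateWeight_nonneg hr h0 h1 s,
      Fintype.sum_prod_type]
    simp [sum_stateWeight_right hr, hr0]
  refine ⟨(PMF.ofFintype _ hsum).toMeasure, inferInstance, fun φ => ?_⟩
  rw [PMF.integral_eq_sum]
  refine Finset.sum_congr rfl fun s _ => ?_
  rw [PMF.ofFintype_apply, ENNReal.toReal_ofReal (stateWeight_nonneg hr h0 h1 s), smul_eq_mul]

/-- Indicator of the initial color being `i`. -/
noncomputable def initInd (i : Fin r) (s : Fin r × Fin r) : ℝ := if s.1 = i then 1 else 0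

/-- Weighted indicator of the color `j` being the initial or the alternative color. -/
noncomputable def eitherInd (l : ℝ) (j : Fin r) (s : Fin r × Fin r) : ℝ :=
  if s.1 = j then 1 else if s.2 = j then l else 0

/-- Weighted indicator of the color `j` being the alternative color. -/
noncomputable def altInd (l : ℝ) (j : Fin r) (s : Fin r × Fin r) : ℝ :=
  if s.2 = j then if s.1 = j then 1 else l else 0

/-- Indicator of the initial and the alternative color being `i` and `j`, in some order. -/
noncomputable def pairInd (i j : Fin r) (s : Fin r × Fin r) : ℝ :=
  if s = (i, j) ∨ s = (j, i) then 1 else 0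

lemma initInd_nonneg (i : Fin r) (s : Fin r × Fin r) : 0 ≤ initInd i s := by
  unfold initInd; split_ifs <;> norm_num

lemma eitherInd_nonneg {l : ℝ} (hl : 0 ≤ l) (j : Fin r) (s : Fin r × Fin r) :
    0 ≤ eitherInd l j s := by
  unfold eitherInd; split_ifs <;> first | exact hl | norm_num

lemma altInd_nonneg {l : ℝ} (hl : 0 ≤ l) (j : Fin r) (s : Fin r × Fin r) :
    0 ≤ altInd l j s := by
  unfold altInd; split_ifs <;> first | exact hl | norm_num

lemma pairInd_nonneg (i j : Fin r) (s : Fin r × Fin r) : 0 ≤ pairInd i j s := by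
  unfold pairInd; split_ifs <;> norm_num

lemma sum_initInd (hr : 2 ≤ r) (i : Fin r) :
    ∑ s, stateWeight r q s * initInd i s = 1 / r := by
  rw [Fintype.sum_prod_type]
  simp [initInd, sum_stateWeight_right hr]

lemma sum_altColor (hr : 2 ≤ r) (i : Fin r) :
    ∑ s : Fin r × Fin r, stateWeight r q s * (if s.2 = i then 1 else 0) = 1 / r := by
  rw [Fintype.sum_prod_type, Finset.sum_comm]
  simp [sum_stateWeight_left hr]

lemma sum_single (a : Fin r × Fin r) :
    ∑ s, stateWeight r q s * (if s = a then 1 else 0) = stateWeight r q a := by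
  simp

lemma sum_eitherInd (hr : 2 ≤ r) (l : ℝ) (j : Fin r) :
    ∑ s, stateWeight r q s * eitherInd l j s = (1 + q * l) / r := by
  have h : ∀ s, stateWeight r q s * eitherInd l j s = stateWeight r q s * initInd j s +
      l * (stateWeight r q s * (if s.2 = j then 1 else 0)) -
      l * (stateWeight r q s * (if s = (j, j) then 1 else 0)) := by
    rintro ⟨c, g⟩
    unfold eitherInd initInd
    by_cases hc : c = j <;> by_cases hg : g = j <;> simp [hc, hg]
    ring
  rw [Finset.sum_congr rfl fun s _ => h s, Finset.sum_sub_distrib, Finset.sum_add_distrib,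
    ← Finset.mul_sum, ← Finset.mul_sum, sum_initInd hr, sum_altColor hr, sum_single]
  simp [stateWeight]
  ring

lemma sum_altInd (hr : 2 ≤ r) (l : ℝ) (j : Fin r) :
    ∑ s, stateWeight r q s * altInd l j s = (1 - q + q * l) / r := by
  have h : ∀ s, stateWeight r q s * altInd l j s =
      l * (stateWeight r q s * (if s.2 = j then 1 else 0)) +
      (1 - l) * (stateWeight r q s * (if s = (j, j) then 1 else 0)) := by
    rintro ⟨c, g⟩
    unfold altInd
    by_cases hc : c = j <;> by_cases hg : g = j <;> simp [hc, hg]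
    all_goals ring
  rw [Finset.sum_congr rfl fun s _ => h s, Finset.sum_add_distrib,
    ← Finset.mul_sum, ← Finset.mul_sum, sum_altColor hr, sum_single]
  simp [stateWeight]
  ring

lemma sum_pairInd {i j : Fin r} (hij : i ≠ j) :
    ∑ s, stateWeight r q s * pairInd i j s = 2 * q / (r * (r - 1)) := by
  have h : ∀ s, stateWeight r q s * pairInd i j s =
      stateWeight r q s * (if s = (i, j) then 1 else 0) +
      stateWeight r q s * (if s = (j, i) then 1 else 0) := by
    rintro ⟨c, g⟩
    unfold pairInd
    by_cases hc : c = i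
    · simp [hc, hij]
    · simp [hc]
  rw [Finset.sum_congr rfl fun s _ => h s, Finset.sum_add_distrib, sum_single, sum_single]
  simp [stateWeight, hij, hij.symm]
  ring

end RecolorMeasure

end HG

namespace HG

open MeasureTheory ProbabilityTheory

section Events

variable {V : Type*} {r : ℕ}

/-- The edge `f` may become monochromatic of color `j` after recoloring fewer than `t` of its
vertices. -/
def Dangerous (t : ℕ) (x : V → Fin r × Fin r) (j : Fin r) (f : Finset V) : Prop :=
  (∀ v ∈ f, (x v).1 = j ∨ (x v).2 = j) ∧ (f.filter fun v => (x v).1 ≠ j).card < t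

/-- Some color `i` is the alternative color of all vertices of `e`, and the initial color of all but
fewer than `t` of them. -/
def stuckEvent (r t : ℕ) (e : Finset V) : Set (V → Fin r × Fin r) :=
  {x | ∃ i, (∀ v ∈ e, (x v).2 = i) ∧ (e.filter fun v => (x v).1 ≠ i).card < t}

/-- All vertices of `e` have the same two distinct colors as initial and alternative colors. -/
def swapEvent (r : ℕ) (e : Finset V) : Set (V → Fin r × Fin r) :=
  {x | ∃ i j, i ≠ j ∧ ∀ v ∈ e, x v = (i, j) ∨ x v = (j, i)}

/-- Each of the edges `e` and `f` can become monochromatic. -/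
def doubleEvent (r : ℕ) (e f : Finset V) : Set (V → Fin r × Fin r) :=
  {x | ∃ i j, (∀ v ∈ e, (x v).1 = i ∨ (x v).2 = i) ∧ ∀ v ∈ f, (x v).1 = j ∨ (x v).2 = j}

lemma Dangerous.congr {t : ℕ} {x y : V → Fin r × Fin r} {j : Fin r} {f : Finset V}
    (hxy : ∀ v ∈ f, x v = y v) (h : Dangerous t x j f) : Dangerous t y j f := by
  refine ⟨fun v hv => hxy v hv ▸ h.1 v hv, ?_⟩
  have : (f.filter fun v => (y v).1 ≠ j) = f.filter fun v => (x v).1 ≠ j :=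
    Finset.filter_congr fun v hv => by rw [hxy v hv]
  rw [this]
  exact h.2

lemma determinedBy_stuckEvent (t : ℕ) (e : Finset V) : DeterminedBy (stuckEvent r t e) e := by
  rintro x y hxy ⟨i, h1, h2⟩
  refine ⟨i, fun v hv => hxy v hv ▸ h1 v hv, ?_⟩
  rwa [Finset.filter_congr fun v hv => by rw [hxy v hv]] at h2

lemma determinedBy_swapEvent (e : Finset V) : DeterminedBy (swapEvent r e) e := by
  rintro x y hxy ⟨i, j, hij, h⟩
  exact ⟨i, j, hij, fun v hv => hxy v hv ▸ h v hv⟩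

/-- A product of factors `L⁻¹`, at most `n` of them, times `L ^ n` is at least one. -/
lemma one_le_pow_mul_prod {L : ℝ} (hL : 1 ≤ L) (T : Finset V) (ψ : V → ℝ) (p : V → Prop)
    [DecidablePred p] (n : ℕ)
    (h1 : ∀ v ∈ T, p v → ψ v = L⁻¹) (h2 : ∀ v ∈ T, ¬ p v → ψ v = 1) (hn : (T.filter p).card ≤ n) :
    1 ≤ L ^ n * ∏ v ∈ T, ψ v := by
  have h : ∏ v ∈ T, ψ v = L⁻¹ ^ (T.filter p).card := by
    rw [← Finset.prod_filter_mul_prod_filter_not T p,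
      Finset.prod_congr rfl fun v hv => h1 v (Finset.mem_filter.1 hv).1 (Finset.mem_filter.1 hv).2,
      Finset.prod_congr (s₁ := T.filter fun v => ¬ p v) rfl
        fun v hv => h2 v (Finset.mem_filter.1 hv).1 (Finset.mem_filter.1 hv).2]
    simp
  have hL0 : 0 < L := by linarith
  rw [h, inv_pow, ← div_eq_mul_inv, one_le_div (by positivity)]
  exact pow_le_pow_right₀ hL hn

variable {q : ℝ} {ν : Measure (Fin r × Fin r)} [IsProbabilityMeasure ν]

lemma real_stuckEvent_le (hr : 2 ≤ r) {L : ℝ} (hL : 1 ≤ L)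
    (hν : ∀ φ : Fin r × Fin r → ℝ, ∫ s, φ s ∂ν = ∑ s, stateWeight r q s * φ s)
    (t : ℕ) (e : Finset V) :
    (Measure.infinitePi fun _ : V => ν).real (stuckEvent r t e) ≤
      r * (L ^ (t - 1) * ((1 - q + q * L⁻¹) / r) ^ e.card) := by
  set A : Fin r → Set (V → Fin r × Fin r) := fun i =>
    {x | (∀ v ∈ e, (x v).2 = i) ∧ (e.filter fun v => (x v).1 ≠ i).card < t} with hA
  have hsub : stuckEvent r t e ⊆ ⋃ i ∈ (Finset.univ : Finset (Fin r)), A i := by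
    rintro x ⟨i, hi⟩
    exact Set.mem_biUnion (Finset.mem_coe.2 (Finset.mem_univ i)) hi
  have hAi : ∀ i, (Measure.infinitePi fun _ : V => ν).real (A i) ≤
      L ^ (t - 1) * ((1 - q + q * L⁻¹) / r) ^ e.card := by
    intro i
    have hL0 : 0 < L := by linarith
    have hdet : DeterminedBy (A i) e := by
      rintro x y hxy ⟨h1, h2⟩
      refine ⟨fun v hv => hxy v hv ▸ h1 v hv, ?_⟩
      rwa [Finset.filter_congr fun v hv => by rw [hxy v hv]] at h2
    refine (real_le_of_le_prod ν e hdet (L ^ (t - 1)) (fun _ => altInd L⁻¹ i)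
      (fun _ s => altInd_nonneg (by positivity) i s) (by positivity) ?_).trans_eq ?_
    · rintro x ⟨h1, h2⟩
      refine one_le_pow_mul_prod hL e _ (fun v => (x v).1 ≠ i) _ ?_ ?_ (by omega)
      · intro v hv hp
        simp [altInd, h1 v hv, hp]
      · intro v hv hp
        simp [altInd, h1 v hv, not_not.1 hp]
    · rw [Finset.prod_const, hν, sum_altInd hr]
  calc _ ≤ _ := measureReal_mono hsub (measure_ne_top _ _)
    _ ≤ ∑ i : Fin r, (Measure.infinitePi fun _ : V => ν).real (A i) :=
      measureReal_biUnion_finset_le _ _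
    _ ≤ ∑ _i : Fin r, L ^ (t - 1) * ((1 - q + q * L⁻¹) / r) ^ e.card :=
      Finset.sum_le_sum fun i _ => hAi i
    _ = _ := by simp

lemma real_swapEvent_le (hr : 2 ≤ r) (hq : 0 ≤ q)
    (hν : ∀ φ : Fin r × Fin r → ℝ, ∫ s, φ s ∂ν = ∑ s, stateWeight r q s * φ s)
    (e : Finset V) :
    (Measure.infinitePi fun _ : V => ν).real (swapEvent r e) ≤
      r * (r * (2 * q / (r * (r - 1))) ^ e.card) := by
  have hr2 : (2 : ℝ) ≤ r := by exact_mod_cast hr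
  have hr1 : (0 : ℝ) ≤ r - 1 := by linarith
  set A : Fin r × Fin r → Set (V → Fin r × Fin r) := fun a =>
    {x | a.1 ≠ a.2 ∧ ∀ v ∈ e, x v = (a.1, a.2) ∨ x v = (a.2, a.1)} with hA
  have hsub : swapEvent r e ⊆ ⋃ a ∈ (Finset.univ : Finset (Fin r × Fin r)), A a := by
    rintro x ⟨i, j, hij⟩
    exact Set.mem_biUnion (Finset.mem_coe.2 (Finset.mem_univ (i, j))) hij
  have hAi : ∀ a, (Measure.infinitePi fun _ : V => ν).real (A a) ≤
      (2 * q / (r * (r - 1))) ^ e.card := by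
    intro a
    by_cases ha : a.1 = a.2
    · have : A a = ∅ := by
        ext x
        simp [hA, ha]
      rw [this, measureReal_empty]
      positivity
    have hdet : DeterminedBy (A a) e := by
      rintro x y hxy ⟨h1, h2⟩
      exact ⟨h1, fun v hv => hxy v hv ▸ h2 v hv⟩
    refine (real_le_of_le_prod ν e hdet 1 (fun _ => pairInd a.1 a.2)
      (fun _ s => pairInd_nonneg _ _ s) zero_le_one ?_).trans_eq ?_
    · rintro x ⟨h1, h2⟩
      rw [one_mul]
      exact (Finset.prod_eq_one fun v hv => if_pos (h2 v hv)).ge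
    · rw [Finset.prod_const, hν, sum_pairInd ha, one_mul]
  calc _ ≤ _ := measureReal_mono hsub (measure_ne_top _ _)
    _ ≤ ∑ a : Fin r × Fin r, (Measure.infinitePi fun _ : V => ν).real (A a) :=
      measureReal_biUnion_finset_le _ _
    _ ≤ ∑ _a : Fin r × Fin r, (2 * q / (r * (r - 1))) ^ e.card :=
      Finset.sum_le_sum fun i _ => hAi i
    _ = _ := by simp [mul_assoc]

variable [DecidableEq V]

/-- The edge `e` can become monochromatic by recoloring vertices in the edges of `F` only, each
of which is dangerous. -/
def coverEvent (r t : ℕ) (e : Finset V) (F : Finset (Finset V)) : Set (V → Fin r × Fin r) :=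
  {x | ∃ (i : Fin r) (j : Finset V → Fin r), (∀ f ∈ F, j f ≠ i) ∧
    (∀ v ∈ e, (x v).1 = i ∨ (x v).2 = i) ∧ (∀ v ∈ e, v ∉ F.biUnion id → (x v).1 = i) ∧
    ∀ f ∈ F, Dangerous t x (j f) f}

/-- `F` is a family of petals attached to `e`: any two petals meet only inside `e`, each petal has a
private vertex in `e`, and together they cover at least `t` vertices of `e`. -/
structure IsFlower (t : ℕ) (e : Finset V) (F : Finset (Finset V)) : Prop where
  card_inter_le : ∀ f ∈ F, (e ∩ f).card ≤ 2
  exists_private : ∀ f ∈ F, ∃ v ∈ e ∩ f, ∀ f' ∈ F, v ∈ f' → f' = f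
  inter_subset : ∀ f ∈ F, ∀ f' ∈ F, f ≠ f' → f ∩ f' ⊆ e
  le_card : t ≤ (e ∩ F.biUnion id).card

lemma determinedBy_doubleEvent (e f : Finset V) : DeterminedBy (doubleEvent r e f) (e ∪ f) := by
  rintro x y hxy ⟨i, j, h1, h2⟩
  exact ⟨i, j, fun v hv => hxy v (Finset.mem_union_left _ hv) ▸ h1 v hv,
    fun v hv => hxy v (Finset.mem_union_right _ hv) ▸ h2 v hv⟩

lemma determinedBy_coverEvent (t : ℕ) (e : Finset V) (F : Finset (Finset V)) :
    DeterminedBy (coverEvent r t e F) (e ∪ F.biUnion id) := by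
  rintro x y hxy ⟨i, j, h0, h1, h2, h3⟩
  have he : ∀ v ∈ e, x v = y v := fun v hv => hxy v (Finset.mem_union_left _ hv)
  refine ⟨i, j, h0, fun v hv => he v hv ▸ h1 v hv, fun v hv hv' => he v hv ▸ h2 v hv hv',
    fun f hf => (h3 f hf).congr fun v hv => hxy v (Finset.mem_union_right _ ?_)⟩
  exact Finset.mem_biUnion.2 ⟨f, hf, hv⟩

lemma real_doubleEvent_le (hr : 2 ≤ r)
    (hν : ∀ φ : Fin r × Fin r → ℝ, ∫ s, φ s ∂ν = ∑ s, stateWeight r q s * φ s)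
    (e f : Finset V) :
    (Measure.infinitePi fun _ : V => ν).real (doubleEvent r e f) ≤
      r * (r * ((1 + q) / r) ^ (e ∪ f).card) := by
  set A : Fin r × Fin r → Set (V → Fin r × Fin r) := fun a =>
    {x | (∀ v ∈ e, (x v).1 = a.1 ∨ (x v).2 = a.1) ∧ ∀ v ∈ f, (x v).1 = a.2 ∨ (x v).2 = a.2}
    with hA
  have hsub : doubleEvent r e f ⊆ ⋃ a ∈ (Finset.univ : Finset (Fin r × Fin r)), A a := by
    rintro x ⟨i, j, hij⟩
    exact Set.mem_biUnion (Finset.mem_coe.2 (Finset.mem_univ (i, j))) hij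
  have hAi : ∀ a, (Measure.infinitePi fun _ : V => ν).real (A a) ≤
      ((1 + q) / r) ^ (e ∪ f).card := by
    intro a
    have hdet : DeterminedBy (A a) (e ∪ f) := by
      rintro x y hxy ⟨h1, h2⟩
      exact ⟨fun v hv => hxy v (Finset.mem_union_left _ hv) ▸ h1 v hv,
        fun v hv => hxy v (Finset.mem_union_right _ hv) ▸ h2 v hv⟩
    refine (real_le_of_le_prod ν (e ∪ f) hdet 1
      (fun v => eitherInd 1 (if v ∈ e then a.1 else a.2))
      (fun _ s => eitherInd_nonneg zero_le_one _ s) zero_le_one ?_).trans_eq ?_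
    · rintro x ⟨h1, h2⟩
      rw [one_mul]
      refine (Finset.prod_eq_one fun v hv => ?_).ge
      have : (x v).1 = (if v ∈ e then a.1 else a.2) ∨ (x v).2 = (if v ∈ e then a.1 else a.2) := by
        split_ifs with hve
        · exact h1 v hve
        · exact h2 v ((Finset.mem_union.1 hv).resolve_left hve)
      rcases this with h | h <;> simp [eitherInd, h]
    · simp [hν, sum_eitherInd hr, div_pow]
  calc _ ≤ _ := measureReal_mono hsub (measure_ne_top _ _)
    _ ≤ ∑ a : Fin r × Fin r, (Measure.infinitePi fun _ : V => ν).real (A a) :=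
      measureReal_biUnion_finset_le _ _
    _ ≤ ∑ _a : Fin r × Fin r, ((1 + q) / r) ^ (e ∪ f).card :=
      Finset.sum_le_sum fun i _ => hAi i
    _ = _ := by simp [mul_assoc]

/-- The part of `coverEvent` in which the colors are prescribed. -/
def coverEventWith (t : ℕ) (e : Finset V) (F : Finset (Finset V)) (i : Fin r)
    (j : Finset V → Fin r) : Set (V → Fin r × Fin r) :=
  {x | (∀ f ∈ F, j f ≠ i) ∧
    (∀ v ∈ e, (x v).1 = i ∨ (x v).2 = i) ∧ (∀ v ∈ e, v ∉ F.biUnion id → (x v).1 = i) ∧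
    ∀ f ∈ F, Dangerous t x (j f) f}

lemma eq_or_eq_of_mem_coverEventWith {t : ℕ} {e : Finset V} {F : Finset (Finset V)} {i : Fin r}
    {j : Finset V → Fin r} {x : V → Fin r × Fin r} (hx : x ∈ coverEventWith t e F i j)
    {v : V} {f : Finset V} (hf : f ∈ F) (hve : v ∈ e) (hvf : v ∈ f) :
    x v = (i, j f) ∨ x v = (j f, i) := by
  obtain ⟨h0, h1, -, h3⟩ := hx
  have hne := h0 f hf
  rcases h1 v hve with h | h <;> rcases (h3 f hf).1 v hvf with h' | h'
  · exact absurd (h'.symm.trans h) hne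
  · exact Or.inl (Prod.ext h h')
  · exact Or.inr (Prod.ext h' h)
  · exact absurd (h'.symm.trans h) hne

lemma real_coverEventWith_le (hr : 2 ≤ r) {L : ℝ} (hL : 1 ≤ L) (hq : 0 ≤ q)
    (hν : ∀ φ : Fin r × Fin r → ℝ, ∫ s, φ s ∂ν = ∑ s, stateWeight r q s * φ s)
    (t : ℕ) (e : Finset V) (F : Finset (Finset V)) (i : Fin r) (j : Finset V → Fin r) :
    (Measure.infinitePi fun _ : V => ν).real (coverEventWith t e F i j) ≤
      L ^ (F.card * (t - 1)) * ((1 / r) ^ (e \ F.biUnion id).card *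
        (2 * q / (r * (r - 1))) ^ (e ∩ F.biUnion id).card *
        ((1 + q * L⁻¹) / r) ^ (F.biUnion id \ e).card) := by
  have hr2 : (2 : ℝ) ≤ r := by exact_mod_cast hr
  have hr1 : (0 : ℝ) ≤ r - 1 := by linarith
  have hL0 : 0 < L := by linarith
  by_cases hj : ∀ f ∈ F, j f ≠ i
  swap
  · have : coverEventWith t e F i j = ∅ := by
      ext x
      simp only [Set.mem_empty_iff_false, iff_false]
      exact fun hx => hj hx.1
    rw [this, measureReal_empty]
    positivity
  have hdet : DeterminedBy (coverEventWith t e F i j) (e ∪ F.biUnion id) := by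
    rintro x y hxy ⟨h0, h1, h2, h3⟩
    have he : ∀ v ∈ e, x v = y v := fun v hv => hxy v (Finset.mem_union_left _ hv)
    refine ⟨h0, fun v hv => he v hv ▸ h1 v hv, fun v hv hv' => he v hv ▸ h2 v hv hv',
      fun f hf => (h3 f hf).congr fun v hv => hxy v (Finset.mem_union_right _ ?_)⟩
    exact Finset.mem_biUnion.2 ⟨f, hf, hv⟩
  have hch : ∀ v, ∃ f, v ∈ F.biUnion id → f ∈ F ∧ v ∈ f := by
    intro v
    by_cases hv : v ∈ F.biUnion id
    · obtain ⟨f, hf, hvf⟩ := Finset.mem_biUnion.1 hv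
      exact ⟨f, fun _ => ⟨hf, hvf⟩⟩
    · exact ⟨∅, fun h => absurd h hv⟩
  choose ch hch using hch
  set φ : V → Fin r × Fin r → ℝ := fun v =>
    if v ∈ e then if v ∈ F.biUnion id then pairInd i (j (ch v)) else initInd i
    else eitherInd L⁻¹ (j (ch v)) with hφ
  have hsplit : ∀ ψ : V → ℝ, ∏ v ∈ e ∪ F.biUnion id, ψ v =
      (∏ v ∈ e \ F.biUnion id, ψ v) * (∏ v ∈ e ∩ F.biUnion id, ψ v) *
        ∏ v ∈ F.biUnion id \ e, ψ v := by
    intro ψ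
    rw [← Finset.union_sdiff_self_eq_union, Finset.prod_union Finset.disjoint_sdiff,
      ← Finset.prod_sdiff (Finset.inter_subset_left : e ∩ F.biUnion id ⊆ e),
      Finset.sdiff_inter_self_left]
  have hφ1 : ∀ v ∈ e \ F.biUnion id, φ v = initInd i := by
    intro v hv
    rw [Finset.mem_sdiff] at hv
    simp only [hφ, if_pos hv.1, if_neg hv.2]
  have hφ2 : ∀ v ∈ e ∩ F.biUnion id, φ v = pairInd i (j (ch v)) := by
    intro v hv
    rw [Finset.mem_inter] at hv
    simp only [hφ, if_pos hv.1, if_pos hv.2]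
  have hφ3 : ∀ v ∈ F.biUnion id \ e, φ v = eitherInd L⁻¹ (j (ch v)) := by
    intro v hv
    rw [Finset.mem_sdiff] at hv
    simp only [hφ, if_neg hv.2]
  refine (real_le_of_le_prod ν _ hdet (L ^ (F.card * (t - 1))) φ ?_ (by positivity) ?_).trans_eq ?_
  · intro v s
    simp only [hφ]
    split_ifs
    · exact pairInd_nonneg _ _ _
    · exact initInd_nonneg _ _
    · exact eitherInd_nonneg (by positivity) _ _
  · intro x hx
    have hx' := hx
    obtain ⟨-, h1, h2, h3⟩ := hx'
    rw [hsplit, Finset.prod_eq_one (s := e \ F.biUnion id), Finset.prod_eq_one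
      (s := e ∩ F.biUnion id), one_mul, one_mul]
    · refine one_le_pow_mul_prod hL _ _ (fun v => (x v).1 ≠ j (ch v)) _ ?_ ?_ ?_
      · intro v hv hp
        have hc := hch v (Finset.mem_sdiff.1 hv).1
        have := ((h3 _ hc.1).1 v hc.2).resolve_left hp
        simp [hφ3 v hv, eitherInd, hp, this]
      · intro v hv hp
        simp [hφ3 v hv, eitherInd, not_not.1 hp]
      · calc _ ≤ (F.biUnion fun f => f.filter fun v => (x v).1 ≠ j f).card := by
              apply Finset.card_le_card
              intro v hv
              rw [Finset.mem_filter, Finset.mem_sdiff] at hv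
              have hc := hch v hv.1.1
              exact Finset.mem_biUnion.2 ⟨ch v, hc.1, Finset.mem_filter.2 ⟨hc.2, hv.2⟩⟩
          _ ≤ F.card * (t - 1) := Finset.card_biUnion_le_card_mul _ _ _ fun f hf => by
              have := (h3 f hf).2
              omega
    · intro v hv
      have hc := hch v (Finset.mem_inter.1 hv).2
      rw [hφ2 v hv, pairInd,
        if_pos (eq_or_eq_of_mem_coverEventWith hx hc.1 (Finset.mem_inter.1 hv).1 hc.2)]
    · intro v hv
      rw [hφ1 v hv, initInd, if_pos (h2 v (Finset.mem_sdiff.1 hv).1 (Finset.mem_sdiff.1 hv).2)]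
  · rw [hsplit]
    congr 1
    congr 1
    · congr 1
      · rw [Finset.prod_congr rfl fun v hv => by rw [hφ1 v hv, hν, sum_initInd hr],
          Finset.prod_const]
      · rw [Finset.prod_congr rfl fun v hv => by
            rw [hφ2 v hv, hν, sum_pairInd (hj _ (hch v (Finset.mem_inter.1 hv).2).1).symm],
          Finset.prod_const]
    · rw [Finset.prod_congr rfl fun v hv => by rw [hφ3 v hv, hν, sum_eitherInd hr],
        Finset.prod_const]

end Events

end HG

namespace HG

open MeasureTheory ProbabilityTheory

section Flowers

variable {V : Type*} [DecidableEq V] {r t : ℕ} {e : Finset V} {F : Finset (Finset V)}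

lemma card_add_card_filter_nonempty_erase_le (F : Finset (Finset V)) (π : Finset V → V)
    (hπ : ∀ f ∈ F, π f ∈ e ∩ f) (hF : ∀ f ∈ F, (e ∩ f).card ≤ 2) :
    ∑ f ∈ F, (e ∩ f).card ≤
      F.card + (F.filter fun f => ((e ∩ f).erase (π f)).Nonempty).card := by
  rw [Finset.card_eq_sum_ones F, Finset.card_filter, ← Finset.sum_add_distrib]
  refine Finset.sum_le_sum fun f hf => ?_
  have h1 := Finset.card_erase_add_one (hπ f hf)
  have h2 := hF f hf
  split_ifs with h
  · omega
  · rw [Finset.not_nonempty_iff_eq_empty.1 h] at h1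
    simp at h1
    omega

/-- Choosing a representative in the center for each petal, few representatives suffice when the
petals share many vertices of the center. -/
lemma IsFlower.exists_rep [Nonempty V] (hF : IsFlower t e F) :
    ∃ ρ : Finset V → V, (∀ f ∈ F, ρ f ∈ e ∩ f) ∧
      (F.image ρ).card + ∑ f ∈ F, (e ∩ f).card ≤ (e ∩ F.biUnion id).card + F.card := by
  choose! π hπ hπ' using hF.exists_private
  have hex : ∀ f, ∃ u, (((e ∩ f).erase (π f)).Nonempty → u ∈ (e ∩ f).erase (π f)) ∧
      (¬ ((e ∩ f).erase (π f)).Nonempty → u = π f) := by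
    intro f
    by_cases h : ((e ∩ f).erase (π f)).Nonempty
    · exact ⟨h.choose, fun _ => h.choose_spec, fun h' => absurd h h'⟩
    · exact ⟨π f, fun h' => absurd h' h, fun _ => rfl⟩
  choose ρ hρ hρ' using hex
  have hmem : ∀ f ∈ F, ρ f ∈ e ∩ f := by
    intro f hf
    by_cases h : ((e ∩ f).erase (π f)).Nonempty
    · exact Finset.mem_of_mem_erase (hρ f h)
    · rw [hρ' f h]
      exact hπ f hf
  refine ⟨ρ, hmem, ?_⟩
  have hsum := card_add_card_filter_nonempty_erase_le F π hπ hF.card_inter_le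
  set F₂ := F.filter fun f => ((e ∩ f).erase (π f)).Nonempty with hF₂
  have hsub : ∀ f ∈ F, ∀ v ∈ e ∩ f, v ∈ e ∩ F.biUnion id := by
    intro f hf v hv
    rw [Finset.mem_inter] at hv ⊢
    exact ⟨hv.1, Finset.mem_biUnion.2 ⟨f, hf, hv.2⟩⟩
  have hcard : (F₂.image π).card = F₂.card := by
    refine Finset.card_image_of_injOn fun f hf f' hf' hff => ?_
    have h1 := (Finset.mem_filter.1 (Finset.mem_coe.1 hf)).1
    have h2 := (Finset.mem_filter.1 (Finset.mem_coe.1 hf')).1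
    exact hπ' f' h2 f h1 (hff ▸ (Finset.mem_inter.1 (hπ f h1)).2)
  have hdisj : Disjoint (F.image ρ) (F₂.image π) := by
    rw [Finset.disjoint_left]
    intro v hv hv'
    obtain ⟨f, hf, rfl⟩ := Finset.mem_image.1 hv
    obtain ⟨f', hf', hff⟩ := Finset.mem_image.1 hv'
    have h1 := Finset.mem_filter.1 hf'
    have h2 : f = f' := hπ' f' h1.1 f hf (hff ▸ (Finset.mem_inter.1 (hmem f hf)).2)
    subst h2
    exact Finset.ne_of_mem_erase (hρ f h1.2) hff.symm
  have hunion : F.image ρ ∪ F₂.image π ⊆ e ∩ F.biUnion id := by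
    refine Finset.union_subset ?_ ?_
    · intro v hv
      obtain ⟨f, hf, rfl⟩ := Finset.mem_image.1 hv
      exact hsub f hf _ (hmem f hf)
    · intro v hv
      obtain ⟨f, hf, rfl⟩ := Finset.mem_image.1 hv
      exact hsub f (Finset.mem_filter.1 hf).1 _ (hπ f (Finset.mem_filter.1 hf).1)
  have := Finset.card_le_card hunion
  rw [Finset.card_union_of_disjoint hdisj, hcard] at this
  omega

lemma IsFlower.card_le [Nonempty V] (hF : IsFlower t e F) : F.card ≤ (e ∩ F.biUnion id).card := by
  choose! π hπ hπ' using hF.exists_private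
  refine Finset.card_le_card_of_injOn π ?_ ?_
  · intro f hf
    have := Finset.mem_inter.1 (hπ f hf)
    exact Finset.mem_inter.2 ⟨this.1, Finset.mem_biUnion.2 ⟨f, hf, this.2⟩⟩
  · intro f hf f' hf' hff
    exact hπ' f' hf' f hf (hff ▸ (Finset.mem_inter.1 (hπ f hf)).2)

lemma IsFlower.card_sdiff_add (hF : IsFlower t e F) {k : ℕ} (hk : ∀ f ∈ F, f.card = k) :
    (F.biUnion id \ e).card + ∑ f ∈ F, (e ∩ f).card = k * F.card := by
  have h1 : F.biUnion id \ e = F.biUnion fun f => f \ e := by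
    ext v
    simp only [Finset.mem_sdiff, Finset.mem_biUnion, id]
    tauto
  rw [h1, Finset.card_biUnion, ← Finset.sum_add_distrib, mul_comm, ← smul_eq_mul,
    ← Finset.sum_const]
  · refine Finset.sum_congr rfl fun f hf => ?_
    rw [Finset.inter_comm, Finset.card_sdiff_add_card_inter, hk f hf]
  · intro f hf f' hf' hff
    rw [Function.onFun, Finset.disjoint_left]
    intro v hv hv'
    rw [Finset.mem_sdiff] at hv hv'
    exact hv.2 (hF.inter_subset f hf f' hf' hff (Finset.mem_inter.2 ⟨hv.1, hv'.1⟩))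

/-- The colors of the petals in `coverEvent` only depend on those of their representatives. -/
lemma coverEvent_subset_iUnion (ρ : Finset V → V) (hρ : ∀ f ∈ F, ρ f ∈ e ∩ f) :
    coverEvent r t e F ⊆ ⋃ a ∈ (Finset.univ : Finset (Fin r × (F.image ρ → Fin r))),
      coverEventWith t e F a.1
        fun f => if h : f ∈ F then a.2 ⟨ρ f, Finset.mem_image_of_mem ρ h⟩ else a.1 := by
  rintro x ⟨i, j, hx⟩
  have hx' : x ∈ coverEventWith t e F i j := hx
  have hch : ∀ u : F.image ρ, ∃ f, f ∈ F ∧ ρ f = u := fun u => by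
    simpa using Finset.mem_image.1 u.2
  choose g hgF hgρ using hch
  have hj : ∀ f (hf : f ∈ F), j (g ⟨ρ f, Finset.mem_image_of_mem ρ hf⟩) = j f := by
    intro f hf
    set f' := g ⟨ρ f, Finset.mem_image_of_mem ρ hf⟩ with hf'
    have h1 : f' ∈ F := hgF _
    have h2 : ρ f' = ρ f := hgρ _
    have h3 := Finset.mem_inter.1 (hρ f hf)
    have h4 := (Finset.mem_inter.1 (hρ f' h1)).2
    rw [h2] at h4
    have h5 := hx.1 f hf
    have h6 := hx.1 f' h1
    rcases eq_or_eq_of_mem_coverEventWith hx' hf h3.1 h3.2 with h | h <;>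
      rcases eq_or_eq_of_mem_coverEventWith hx' h1 h3.1 h4 with h' | h' <;>
      · rw [h, Prod.mk.injEq] at h'
        first
        | exact h'.2.symm
        | exact h'.1.symm
        | exact absurd h'.1.symm h6
        | exact absurd h'.2.symm h6
  refine Set.mem_biUnion (x := (i, fun u => j (g u))) (Finset.mem_coe.2 (Finset.mem_univ _)) ?_
  refine ⟨fun f hf => ?_, hx.2.1, hx.2.2.1, fun f hf => ?_⟩
  · simpa only [dif_pos hf, hj f hf] using hx.1 f hf
  · simpa only [dif_pos hf, hj f hf] using hx.2.2.2 f hf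

lemma one_add_one_div_pow_le {k n m : ℕ} (hk : 1 ≤ k) (hn : n ≤ k * m) :
    (1 + 1 / (k : ℝ)) ^ n ≤ 3 ^ m := by
  have hk0 : (0 : ℝ) < k := by exact_mod_cast hk
  calc (1 + 1 / (k : ℝ)) ^ n ≤ (1 + 1 / (k : ℝ)) ^ (k * m) :=
        pow_le_pow_right₀ (by simp) hn
    _ ≤ (Real.exp (1 / k)) ^ (k * m) := by
        refine pow_le_pow_left₀ (by positivity) ?_ _
        rw [add_comm]
        exact Real.add_one_le_exp _
    _ = (Real.exp 1) ^ m := by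
        rw [pow_mul, ← Real.exp_nat_mul, mul_one_div_cancel hk0.ne']
    _ ≤ 3 ^ m := by
        refine pow_le_pow_left₀ (Real.exp_pos _).le ?_ _
        linarith [Real.exp_one_lt_d9]

lemma pow_mul_inv_pow_le {x : ℝ} (hx : 1 ≤ x) {a b c : ℕ} (h : a + c ≤ b) :
    x ^ a * x⁻¹ ^ b ≤ x⁻¹ ^ c := by
  have hx0 : 0 < x := by linarith
  obtain ⟨d, rfl⟩ := Nat.exists_eq_add_of_le h
  have : x ^ a * x⁻¹ ^ (a + c + d) = x⁻¹ ^ c * x⁻¹ ^ d := by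
    rw [pow_add, pow_add, ← mul_assoc, ← mul_assoc, ← mul_pow, mul_inv_cancel₀ hx0.ne', one_pow,
      one_mul]
  rw [this]
  exact mul_le_of_le_one_right (by positivity)
    (pow_le_one₀ (by positivity) (inv_le_one_of_one_le₀ hx))

lemma real_coverEvent_le [Nonempty V] {q L : ℝ} {ν : Measure (Fin r × Fin r)}
    [IsProbabilityMeasure ν] (hr : 2 ≤ r) (hL : 1 ≤ L) (hq : 0 ≤ q)
    (hν : ∀ φ : Fin r × Fin r → ℝ, ∫ s, φ s ∂ν = ∑ s, stateWeight r q s * φ s)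
    (hF : IsFlower t e F) {k : ℕ} (hk1 : 1 ≤ k) (hke : e.card = k) (hkF : ∀ f ∈ F, f.card = k)
    (hqL : q * L⁻¹ = 1 / k) :
    (Measure.infinitePi fun _ : V => ν).real (coverEvent r t e F) ≤
      (r : ℝ)⁻¹ ^ ((k - 1) * (F.card + 1)) * (4 * q) ^ (e ∩ F.biUnion id).card *
        (3 * L ^ (t - 1)) ^ F.card := by
  obtain ⟨ρ, hρ, hcard⟩ := hF.exists_rep
  have hr2 : (2 : ℝ) ≤ r := by exact_mod_cast hr
  have hr0 : (0 : ℝ) < r := by linarith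
  have hn := hF.card_sdiff_add hkF
  have hw : (e \ F.biUnion id).card + (e ∩ F.biUnion id).card = k := by
    rw [Finset.card_sdiff_add_card_inter, hke]
  set w := (e ∩ F.biUnion id).card
  set m := F.card
  set n := (F.biUnion id \ e).card
  set u := (e \ F.biUnion id).card
  set R := (F.image ρ).card with hR
  have hterm : L ^ (m * (t - 1)) * ((1 / (r : ℝ)) ^ u * (2 * q / (r * (r - 1))) ^ w *
      ((1 + q * L⁻¹) / r) ^ n) ≤
      (4 * q) ^ w * (3 * L ^ (t - 1)) ^ m * (r : ℝ)⁻¹ ^ (u + 2 * w + n) := by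
    have h1 : 2 * q / (r * (r - 1)) ≤ 4 * q * (r : ℝ)⁻¹ ^ 2 := by
      rw [inv_pow, ← div_eq_mul_inv, div_le_div_iff₀ (by nlinarith) (by positivity)]
      have : 0 ≤ q * r * (r - 2) := by
        have : (0 : ℝ) ≤ r - 2 := by linarith
        positivity
      nlinarith
    have h2 : ((1 + q * L⁻¹) / r) ^ n ≤ 3 ^ m * (r : ℝ)⁻¹ ^ n := by
      rw [hqL, div_eq_mul_inv, mul_pow]
      gcongr
      exact one_add_one_div_pow_le hk1 (by omega)
    have h3 : (0 : ℝ) ≤ 2 * q / (r * (r - 1)) := by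
      have : (0 : ℝ) ≤ r - 1 := by linarith
      positivity
    have h4 : (0 : ℝ) ≤ (1 + q * L⁻¹) / r := by
      rw [hqL]
      positivity
    calc _ ≤ L ^ (m * (t - 1)) * ((1 / (r : ℝ)) ^ u * (4 * q * (r : ℝ)⁻¹ ^ 2) ^ w *
          (3 ^ m * (r : ℝ)⁻¹ ^ n)) := by gcongr
      _ = _ := by
        rw [one_div, mul_pow, mul_pow 3, ← pow_mul L, mul_comm m, pow_add, pow_add, pow_mul]
        ring
  have hcount : (Finset.univ : Finset (Fin r × (F.image ρ → Fin r))).card = r ^ (1 + R) := by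
    simp [hR, pow_add]
  calc _ ≤ _ := measureReal_mono (coverEvent_subset_iUnion ρ hρ) (measure_ne_top _ _)
    _ ≤ _ := measureReal_biUnion_finset_le _ _
    _ ≤ ∑ _a : Fin r × (F.image ρ → Fin r), (4 * q) ^ w * (3 * L ^ (t - 1)) ^ m *
        (r : ℝ)⁻¹ ^ (u + 2 * w + n) :=
      Finset.sum_le_sum fun a _ =>
        (real_coverEventWith_le hr hL hq hν t e F a.1 _).trans hterm
    _ = (4 * q) ^ w * (3 * L ^ (t - 1)) ^ m *
        ((r : ℝ) ^ (1 + R) * (r : ℝ)⁻¹ ^ (u + 2 * w + n)) := by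
      rw [Finset.sum_const, hcount, nsmul_eq_mul]
      push_cast
      ring
    _ ≤ (4 * q) ^ w * (3 * L ^ (t - 1)) ^ m * (r : ℝ)⁻¹ ^ ((k - 1) * (m + 1)) := by
      gcongr
      refine pow_mul_inv_pow_le (by linarith) ?_
      obtain ⟨k, rfl⟩ := Nat.exists_eq_add_of_le' hk1
      simp only [Nat.add_sub_cancel]
      nlinarith
    _ = _ := by ring

end Flowers

end HG

namespace HG

section Recoloring

variable {V : Type*} [DecidableEq V] {r t : ℕ}

/-- The edges other than `e` that meet `e`. -/
def neighbors (E : Finset (Finset V)) (e : Finset V) : Finset (Finset V) :=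
  (E.erase e).filter fun f => (e ∩ f).Nonempty

lemma mem_neighbors {E : Finset (Finset V)} {e f : Finset V} :
    f ∈ neighbors E e ↔ f ≠ e ∧ f ∈ E ∧ (e ∩ f).Nonempty := by
  rw [neighbors, Finset.mem_filter, Finset.mem_erase, and_assoc]

/-- A minimal subfamily covering a set has a private element in each of its members. -/
lemma exists_minimal_cover (P : Finset (Finset V)) (S : Finset V) (hS : S ⊆ P.biUnion id) :
    ∃ F ⊆ P, S ⊆ F.biUnion id ∧ ∀ f ∈ F, ∃ v ∈ S ∩ f, ∀ f' ∈ F, v ∈ f' → f' = f := by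
  obtain ⟨F, hF, hmin⟩ := Finset.exists_min_image
    (P.powerset.filter fun F => S ⊆ F.biUnion id) Finset.card
    ⟨P, Finset.mem_filter.2 ⟨Finset.mem_powerset_self P, hS⟩⟩
  rw [Finset.mem_filter, Finset.mem_powerset] at hF
  refine ⟨F, hF.1, hF.2, fun f hf => ?_⟩
  have h : ¬ S ⊆ (F.erase f).biUnion id := by
    intro h
    have := hmin (F.erase f) (Finset.mem_filter.2
      ⟨Finset.mem_powerset.2 ((Finset.erase_subset _ _).trans hF.1), h⟩)
    exact absurd this (not_le.2 (Finset.card_erase_lt_of_mem hf))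
  obtain ⟨v, hvS, hv⟩ := Finset.not_subset.1 h
  have huniq : ∀ f' ∈ F, v ∈ f' → f' = f := by
    intro f' hf' hvf'
    by_contra hne
    exact hv (Finset.mem_biUnion.2 ⟨f', Finset.mem_erase.2 ⟨hne, hf'⟩, hvf'⟩)
  obtain ⟨f', hf', hvf'⟩ := Finset.mem_biUnion.1 (hF.2 hvS)
  exact ⟨v, Finset.mem_inter.2 ⟨hvS, huniq f' hf' hvf' ▸ hvf'⟩, huniq⟩

/-- If none of the bad events holds, switching every vertex whose initial color is endangered by an
edge to its alternative color produces a proper coloring. -/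
theorem rColorable_of_notMem (E : Finset (Finset V)) (hne : ∀ e ∈ E, e.Nonempty)
    (hsimple : TwoSimple E) (x : V → Fin r × Fin r)
    (hstuck : ∀ e ∈ E, x ∉ stuckEvent r t e) (hswap : ∀ e ∈ E, x ∉ swapEvent r e)
    (hdouble : ∀ e ∈ E, ∀ f ∈ E, (∃ f' ∈ E, IsTriangle e f f') → x ∉ doubleEvent r e f)
    (hcover : ∀ e ∈ E, ∀ F ⊆ neighbors E e, IsFlower t e F → x ∉ coverEvent r t e F) :
    RColorable r E := by
  set c : V → Fin r := fun v =>
    if ∃ f ∈ E, v ∈ f ∧ Dangerous t x (x v).1 f then (x v).2 else (x v).1 with hc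
  refine ⟨c, fun e he hmono => ?_⟩
  obtain ⟨v₀, hv₀⟩ := hne e he
  obtain ⟨i, hi⟩ : ∃ i, ∀ v ∈ e, c v = i := ⟨c v₀, fun v hv => hmono v hv v₀ hv₀⟩
  have hor : ∀ v ∈ e, (x v).1 = i ∨ (x v).2 = i := by
    intro v hv
    have := hi v hv
    simp only [hc] at this
    split_ifs at this
    · exact Or.inr this
    · exact Or.inl this
  have hdang : ∀ v ∈ e, (x v).1 ≠ i → ∃ f ∈ E, v ∈ f ∧ Dangerous t x (x v).1 f := by
    intro v hv hvi
    have := hi v hv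
    simp only [hc] at this
    split_ifs at this with h
    · exact h
    · exact absurd this hvi
  set S := e.filter fun v => (x v).1 ≠ i with hS
  by_cases hSt : S.card < t
  · refine hstuck e he ⟨i, fun v hv => ?_, hSt⟩
    by_cases hvi : (x v).1 = i
    · have := hi v hv
      simp only [hc] at this
      rwa [if_pos ⟨e, he, hv, hvi ▸ ⟨hor, hSt⟩⟩] at this
    · exact (hor v hv).resolve_left hvi
  · push Not at hSt
    have hself : ∀ j, j ≠ i → ¬ Dangerous t x j e := by
      intro j hji hd
      refine hswap e he ⟨i, j, hji.symm, fun v hv => ?_⟩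
      rcases hor v hv with h | h <;> rcases hd.1 v hv with h' | h'
      · exact absurd (h'.symm.trans h) hji
      · exact Or.inl (Prod.ext h h')
      · exact Or.inr (Prod.ext h' h)
      · exact absurd (h'.symm.trans h) hji
    obtain ⟨F, hFP, hSF, hpriv⟩ := exists_minimal_cover
      ((neighbors E e).filter fun f => ∃ j, j ≠ i ∧ Dangerous t x j f) S (by
        intro v hv
        rw [hS, Finset.mem_filter] at hv
        obtain ⟨f, hf, hvf, hd⟩ := hdang v hv.1 hv.2
        refine Finset.mem_biUnion.2 ⟨f, Finset.mem_filter.2 ⟨mem_neighbors.2 ⟨?_, hf,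
          v, Finset.mem_inter.2 ⟨hv.1, hvf⟩⟩, (x v).1, hv.2, hd⟩, hvf⟩
        rintro rfl
        exact hself _ hv.2 hd)
    have hFn : F ⊆ neighbors E e := hFP.trans (Finset.filter_subset _ _)
    have hFj : ∀ f, ∃ j, f ∈ F → j ≠ i ∧ Dangerous t x j f := by
      intro f
      by_cases hf : f ∈ F
      · obtain ⟨j, hj⟩ := (Finset.mem_filter.1 (hFP hf)).2
        exact ⟨j, fun _ => hj⟩
      · exact ⟨i, fun h => absurd h hf⟩
    choose j hj using hFj
    have hSe : S ⊆ e := Finset.filter_subset _ _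
    refine hcover e he F hFn ⟨fun f hf => ?_, fun f hf => ?_, fun f hf f' hf' hff v hv => ?_, ?_⟩
      ⟨i, j, fun f hf => (hj f hf).1, hor, fun v hv hvF => ?_, fun f hf => (hj f hf).2⟩
    · have := mem_neighbors.1 (hFn hf)
      exact hsimple e he f this.2.1 this.1.symm
    · obtain ⟨v, hv, h⟩ := hpriv f hf
      exact ⟨v, Finset.inter_subset_inter_right hSe hv, h⟩
    · by_contra hve
      have h1 := mem_neighbors.1 (hFn hf)
      have h2 := mem_neighbors.1 (hFn hf')
      obtain ⟨u, hu, hu'⟩ := hpriv f hf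
      obtain ⟨u', hu₁, hu₂⟩ := hpriv f' hf'
      rw [Finset.mem_inter] at hu hu₁
      refine hdouble e he f h1.2.1 ⟨f', h2.2.1, h1.1.symm, h2.1.symm, hff, ⟨u, ?_⟩, ⟨u', ?_⟩,
        ⟨v, Finset.mem_sdiff.2 ⟨hv, hve⟩⟩⟩ ⟨i, j f, hor, (hj f hf).2.1⟩
      · exact Finset.mem_sdiff.2 ⟨Finset.mem_inter.2 ⟨hSe hu.1, hu.2⟩,
          fun h => hff (hu' f' hf' h).symm⟩
      · exact Finset.mem_sdiff.2 ⟨Finset.mem_inter.2 ⟨hSe hu₁.1, hu₁.2⟩,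
          fun h => hff (hu₂ f hf h)⟩
    · exact hSt.trans (Finset.card_le_card (Finset.subset_inter hSe hSF))
    · by_contra hvi
      exact hvF (hSF (Finset.mem_filter.2 ⟨hv, hvi⟩))

end Recoloring

end HG

namespace HG

section Parameters

lemma twenty_four_le_of_nine_mul_log_le {L : ℝ} (h2 : 2 ≤ L) (h : 9 * Real.log L ≤ L) : 24 ≤ L := by
  have key : ∀ n : ℕ, (2 : ℝ) ^ n ≤ L → 6 * (n : ℝ) ≤ L := by
    intro n hn
    have := Real.log_le_log (by positivity) hn
    rw [Real.log_pow] at this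
    nlinarith [Real.log_two_gt_d9, (Nat.cast_nonneg n : (0 : ℝ) ≤ n)]
  have h6 := key 1 (by linarith)
  have h12 := key 2 (by norm_num at h6 ⊢; linarith)
  have h18 := key 3 (by norm_num at h12 ⊢; linarith)
  have h24 := key 4 (by norm_num at h18 ⊢; linarith)
  norm_num at h24
  exact h24

variable {k ω t : ℕ} {b α q L : ℝ}

lemma pow_sq_le_of_eq_floor (hk : 3 ≤ k) (hL2 : 2 ≤ L)
    (ht : t = ⌊Real.sqrt (Real.log k / Real.log L)⌋₊) :
    (t : ℝ) ^ 2 * Real.log L ≤ Real.log k ∧ L ^ (t ^ 2) ≤ k := by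
  have hk0 : (0 : ℝ) < k := by positivity
  have hlogk : 0 ≤ Real.log k := Real.log_nonneg (by exact_mod_cast (by omega : 1 ≤ k))
  have hlogL : 0 < Real.log L := Real.log_pos (by linarith)
  have h1 : (t : ℝ) ≤ Real.sqrt (Real.log k / Real.log L) := by
    rw [ht]
    exact Nat.floor_le (Real.sqrt_nonneg _)
  have h2 : (t : ℝ) ^ 2 * Real.log L ≤ Real.log k := by
    rw [← le_div_iff₀ hlogL]
    exact (Real.le_sqrt (by positivity) (by positivity)).1 h1
  refine ⟨h2, ?_⟩
  rw [← Real.log_le_log_iff (by positivity) hk0, Real.log_pow]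
  push_cast
  exact h2

/-- The numerical consequences of the hypotheses of the main theorem which its proof uses. -/
lemma parameter_bounds (hk : 3 ≤ k) (hb : 0 < b) (hL : L = α * Real.log k)
    (hL2 : 2 ≤ L) (ht : t = ⌊Real.sqrt (Real.log k / Real.log L)⌋₊) (hbt : b ≤ t)
    (hmain : (k : ℝ) ^ 2 / 2 ^ k
        + ((t : ℝ) + 1) * (k : ℝ) ^ ((1 : ℝ) - α) *
          Real.exp (L * ((t : ℝ) + (ω : ℝ)) / k) * L ^ (t + ω)
        + (((t : ℝ) + 1) ^ 2 / (t.factorial : ℝ)) * (k : ℝ) ^ ((2 : ℝ) - b) * L ^ (t * ω)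
        + ((t : ℝ) + 1) * (t : ℝ) * ((2 * Real.exp 1 * L) / ((t : ℝ) - 1)) ^ (t - 1) *
          (k : ℝ) ^ ((1 : ℝ) + α - b)
        < 1 / 4) :
    3 ≤ t ∧ 2 ≤ b ∧ 24 ≤ L ∧ L ^ (t ^ 2) ≤ k ∧
      ((t : ℝ) + 1) * (k : ℝ) ^ ((1 : ℝ) - α) * L ^ (t + ω) < 1 / 4 := by
  have hk1 : (1 : ℝ) ≤ k := by exact_mod_cast (by omega : 1 ≤ k)
  have hk0 : (0 : ℝ) < k := by linarith
  have ht0 : (0 : ℝ) < t := hb.trans_le hbt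
  have ht1 : 1 ≤ t := by exact_mod_cast ht0
  have ht1' : (1 : ℝ) ≤ t := by exact_mod_cast ht1
  have hlogk : 0 ≤ Real.log k := Real.log_nonneg hk1
  obtain ⟨hsq, hpow⟩ := pow_sq_le_of_eq_floor hk hL2 ht
  have hL1 : 1 ≤ L := by linarith
  have hlogL : Real.log 2 ≤ Real.log L := Real.log_le_log (by norm_num) hL2
  have h2log := Real.log_two_gt_d9
  have hT1 : 0 ≤ (k : ℝ) ^ 2 / 2 ^ k := by positivity
  have hT3 : 0 ≤ (((t : ℝ) + 1) ^ 2 / (t.factorial : ℝ)) * (k : ℝ) ^ ((2 : ℝ) - b) *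
      L ^ (t * ω) := by positivity
  have hX : 0 ≤ (2 * Real.exp 1 * L) / ((t : ℝ) - 1) :=
    div_nonneg (by positivity) (by linarith)
  have hT4 : 0 ≤ ((t : ℝ) + 1) * (t : ℝ) * ((2 * Real.exp 1 * L) / ((t : ℝ) - 1)) ^ (t - 1) *
      (k : ℝ) ^ ((1 : ℝ) + α - b) := by positivity
  have hexp : 1 ≤ Real.exp (L * ((t : ℝ) + (ω : ℝ)) / k) :=
    Real.one_le_exp (by positivity)
  have hT2 : ((t : ℝ) + 1) * (k : ℝ) ^ ((1 : ℝ) - α) * L ^ (t + ω) ≤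
      ((t : ℝ) + 1) * (k : ℝ) ^ ((1 : ℝ) - α) *
        Real.exp (L * ((t : ℝ) + (ω : ℝ)) / k) * L ^ (t + ω) := by
    exact mul_le_mul_of_nonneg_right (le_mul_of_one_le_right (by positivity) hexp) (by positivity)
  have hT2' : 0 ≤ ((t : ℝ) + 1) * (k : ℝ) ^ ((1 : ℝ) - α) * L ^ (t + ω) := by positivity
  have hα1 : 1 < α := by
    by_contra! h
    have h1 : 1 ≤ (k : ℝ) ^ ((1 : ℝ) - α) := Real.one_le_rpow hk1 (by linarith)
    have h2 : 1 ≤ L ^ (t + ω) := one_le_pow₀ hL1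
    have h3 : 1 ≤ ((t : ℝ) + 1) * (k : ℝ) ^ ((1 : ℝ) - α) :=
      one_le_mul_of_one_le_of_one_le (by linarith) h1
    have h4 := one_le_mul_of_one_le_of_one_le h3 h2
    linarith
  have hkL : Real.log k ≤ L := by
    rw [hL]
    exact le_mul_of_one_le_left hlogk hα1.le
  have htL : (t : ℝ) ≤ 2 * L := by
    have h1 : (t : ℝ) * Real.log 2 ≤ (t : ℝ) ^ 2 * Real.log L := by
      gcongr
      exact le_self_pow₀ ht1' two_ne_zero
    have h2 : (t : ℝ) * (1 / 2) ≤ t * Real.log 2 := by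
      gcongr
      linarith
    linarith
  have hbα : 1 + α < b := by
    by_contra! h
    have h1 : 1 ≤ (k : ℝ) ^ ((1 : ℝ) + α - b) := Real.one_le_rpow hk1 (by linarith)
    have h2 : 1 ≤ ((2 * Real.exp 1 * L) / ((t : ℝ) - 1)) ^ (t - 1) := by
      rcases ht1.eq_or_lt with h | h
      · rw [← h]
        simp
      · have h' : (1 : ℝ) < t := by exact_mod_cast h
        refine one_le_pow₀ ?_
        rw [one_le_div (by linarith)]
        have : 1 * L ≤ Real.exp 1 * L := by
          gcongr
          exact Real.one_le_exp zero_le_one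
        linarith
    have h3 : 1 ≤ ((t : ℝ) + 1) * (t : ℝ) :=
      one_le_mul_of_one_le_of_one_le (by linarith) ht1'
    have h4 := one_le_mul_of_one_le_of_one_le (one_le_mul_of_one_le_of_one_le h3 h2) h1
    linarith
  have ht3 : 3 ≤ t := by
    have : (2 : ℝ) < t := by linarith
    exact_mod_cast this
  have ht3' : (3 : ℝ) ≤ t := by exact_mod_cast ht3
  refine ⟨ht3, by linarith, ?_, hpow, by linarith⟩
  refine twenty_four_le_of_nine_mul_log_le hL2 ?_
  have h9 : (9 : ℝ) * Real.log L ≤ (t : ℝ) ^ 2 * Real.log L := by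
    gcongr
    · linarith
    · nlinarith
  linarith

lemma sq_mul_pow_le {n : ℕ} (hn : 100 ≤ n) : 1024 * (n : ℝ) ^ 2 * (9 / 16) ^ n ≤ 1 := by
  induction n, hn using Nat.le_induction with
  | base => norm_num
  | succ n hn ih =>
    have hn' : (100 : ℝ) ≤ n := by exact_mod_cast hn
    have h : ((n : ℝ) + 1) ^ 2 * (9 / 16) ≤ (n : ℝ) ^ 2 := by nlinarith
    calc 1024 * ((n + 1 : ℕ) : ℝ) ^ 2 * (9 / 16) ^ (n + 1)
        = 1024 * (((n : ℝ) + 1) ^ 2 * (9 / 16)) * (9 / 16) ^ n := by push_cast; ring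
      _ ≤ 1024 * (n : ℝ) ^ 2 * (9 / 16) ^ n := by gcongr
      _ ≤ 1 := ih

lemma le_pow_nine_of_pow_sq_le (ht : 3 ≤ t) (hL : 24 ≤ L) (hpow : L ^ (t ^ 2) ≤ k) :
    L ^ 9 ≤ k :=
  (pow_le_pow_right₀ (by linarith) (by nlinarith)).trans hpow

lemma hundred_le_of_pow_nine_le (hL : 24 ≤ L) (hpow : L ^ 9 ≤ k) : 100 ≤ k := by
  have : (24 : ℝ) ^ 9 ≤ L ^ 9 := by gcongr
  have h : (100 : ℝ) ≤ k := by
    norm_num at this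
    linarith
  exact_mod_cast h

lemma div_le_of_pow_nine_le (hL : 24 ≤ L) (hpow : L ^ 9 ≤ k) : L / k ≤ 1 / 24 := by
  have hL0 : 0 < L := by linarith
  have h9 : 0 < L ^ 9 := by positivity
  rw [div_le_div_iff₀ (by linarith) (by norm_num), one_mul]
  calc L * 24 ≤ L * L ^ 8 := by
        gcongr
        calc (24 : ℝ) ≤ L ^ 1 := by simpa
          _ ≤ L ^ 8 := pow_le_pow_right₀ (by linarith) (by norm_num)
    _ = L ^ 9 := by ring
    _ ≤ k := hpow

/-- The degree condition makes `L ^ (2 * t)` at most `k ^ (b / t)`. -/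
lemma pow_two_mul_le_rpow (hk : 1 ≤ (k : ℝ)) (ht : 1 ≤ t) (hb : 2 ≤ b) (hL : 1 ≤ L)
    (hpow : L ^ (t ^ 2) ≤ k) : L ^ (2 * t) ≤ (k : ℝ) ^ (b / t) := by
  have ht0 : (0 : ℝ) < t := by exact_mod_cast ht
  have hL0 : 0 < L := by linarith
  calc L ^ (2 * t) = (L ^ (t ^ 2)) ^ ((2 : ℝ) / t) := by
        rw [← Real.rpow_natCast, ← Real.rpow_natCast, ← Real.rpow_mul hL0.le]
        congr 1
        push_cast
        field_simp
    _ ≤ (k : ℝ) ^ ((2 : ℝ) / t) := by gcongr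
    _ ≤ (k : ℝ) ^ (b / t) := by gcongr

end Parameters

end HG

namespace HG

section Numerics

variable {k r ω t : ℕ} {α q L N : ℝ}

lemma mul_div_pow_eq {x c : ℝ} (hx : x ≠ 0) (hk : 1 ≤ k) :
    x * (c / x) ^ k = x⁻¹ ^ (k - 1) * c ^ k := by
  obtain ⟨k, rfl⟩ := Nat.exists_eq_add_of_le' hk
  rw [Nat.add_sub_cancel, div_pow, inv_pow, pow_succ x]
  field_simp

lemma stuck_bound (hk : 3 ≤ k) (hr : 2 ≤ r) (hN : 0 < N) (hNk : N * (r : ℝ)⁻¹ ^ (k - 1) ≤ k)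
    (ht : 3 ≤ t) (hL : 24 ≤ L) (hα : L = α * Real.log k) (hq : q = L / k) (hq1 : q ≤ 1)
    (h : ((t : ℝ) + 1) * (k : ℝ) ^ ((1 : ℝ) - α) * L ^ (t + ω) < 1 / 4) :
    2 * (r * (L ^ (t - 1) * ((1 - q + q * L⁻¹) / r) ^ k)) ≤ 1 / (8 * N) := by
  have hk0 : (0 : ℝ) < k := by positivity
  have hr0 : (0 : ℝ) < r := by positivity
  have hL0 : 0 < L := by linarith
  have hqL : q * L⁻¹ = 1 / k := by
    rw [hq]
    field_simp
  have h1 : (1 - q + q * L⁻¹) ^ k ≤ 3 * (k : ℝ) ^ (-α) := by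
    have h0 : 0 ≤ 1 - q + q * L⁻¹ := by
      rw [hqL]
      have : 0 ≤ 1 / (k : ℝ) := by positivity
      linarith
    calc (1 - q + q * L⁻¹) ^ k ≤ Real.exp (-q + 1 / k) ^ k := by
          refine pow_le_pow_left₀ h0 ?_ _
          rw [hqL]
          linarith [Real.add_one_le_exp (-q + 1 / k)]
      _ = Real.exp 1 * (k : ℝ) ^ (-α) := by
          rw [← Real.exp_nat_mul, Real.rpow_def_of_pos hk0, ← Real.exp_add]
          congr 1
          rw [hq, hα]
          field_simp
          ring
      _ ≤ 3 * (k : ℝ) ^ (-α) := by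
          gcongr
          linarith [Real.exp_one_lt_d9]
  have h2 : 96 * ((k : ℝ) ^ ((1 : ℝ) - α) * L ^ (t - 1)) ≤
      ((t : ℝ) + 1) * (k : ℝ) ^ ((1 : ℝ) - α) * L ^ (t + ω) := by
    have ht' : (3 : ℝ) ≤ t := by exact_mod_cast ht
    calc 96 * ((k : ℝ) ^ ((1 : ℝ) - α) * L ^ (t - 1))
        = (3 + 1) * (k : ℝ) ^ ((1 : ℝ) - α) * (L ^ (t - 1) * 24) := by ring
      _ ≤ ((t : ℝ) + 1) * (k : ℝ) ^ ((1 : ℝ) - α) * (L ^ (t - 1) * L) := by gcongr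
      _ ≤ ((t : ℝ) + 1) * (k : ℝ) ^ ((1 : ℝ) - α) * L ^ (t + ω) := by
          gcongr
          rw [← pow_succ]
          exact pow_le_pow_right₀ (by linarith) (by omega)
  have h3 : (k : ℝ) ^ ((1 : ℝ) - α) = k * (k : ℝ) ^ (-α) := by
    rw [sub_eq_add_neg, Real.rpow_add hk0, Real.rpow_one]
  rw [le_div_iff₀ (by positivity)]
  calc 2 * (r * (L ^ (t - 1) * ((1 - q + q * L⁻¹) / r) ^ k)) * (8 * N)
      = 16 * L ^ (t - 1) * N * (r * ((1 - q + q * L⁻¹) / r) ^ k) := by ring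
    _ = 16 * L ^ (t - 1) * (N * (r : ℝ)⁻¹ ^ (k - 1)) * (1 - q + q * L⁻¹) ^ k := by
        rw [mul_div_pow_eq hr0.ne' (by omega)]
        ring
    _ ≤ 16 * L ^ (t - 1) * (N * (r : ℝ)⁻¹ ^ (k - 1)) * (3 * (k : ℝ) ^ (-α)) := by gcongr
    _ ≤ 16 * L ^ (t - 1) * k * (3 * (k : ℝ) ^ (-α)) := by gcongr
    _ = 48 * ((k : ℝ) ^ ((1 : ℝ) - α) * L ^ (t - 1)) := by rw [h3]; ring
    _ ≤ 1 := by linarith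

lemma double_bound (hk : 100 ≤ k) (hr : 2 ≤ r) (hN : 0 < N)
    (hNk : N * (r : ℝ)⁻¹ ^ (k - 1) ≤ k) (hω : ω ≤ k) (hq0 : 0 ≤ q) (hq : q ≤ 1 / 24) {n : ℕ}
    (hn : 2 * k - 2 ≤ n) :
    4 * ω * (4 * (r * (r * ((1 + q) / r) ^ n))) ≤ 1 / (8 * N) := by
  have hr2 : (2 : ℝ) ≤ r := by exact_mod_cast hr
  have hr0 : (0 : ℝ) < r := by linarith
  have hω' : (ω : ℝ) ≤ k := by exact_mod_cast hω
  have h1 : ((1 + q) / r) ^ n ≤ ((1 + q) / r) ^ (2 * (k - 1)) := by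
    refine pow_le_pow_of_le_one (by positivity) ?_ (by omega)
    rw [div_le_one hr0]
    linarith
  have h2 : (r : ℝ) * (r * ((1 + q) / r) ^ (2 * (k - 1))) ≤
      (r : ℝ)⁻¹ ^ (k - 1) * (8 * (9 / 16) ^ k) := by
    have h3 : (r : ℝ) ^ 2 * (r : ℝ)⁻¹ ^ (k - 1) ≤ 8 * 2⁻¹ ^ k := by
      calc (r : ℝ) ^ 2 * (r : ℝ)⁻¹ ^ (k - 1) ≤ (r : ℝ)⁻¹ ^ (k - 3) :=
            pow_mul_inv_pow_le (by linarith) (by omega)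
        _ ≤ 2⁻¹ ^ (k - 3) := by gcongr
        _ = 8 * 2⁻¹ ^ k := by
            obtain ⟨l, rfl⟩ := Nat.exists_eq_add_of_le' (by omega : 3 ≤ k)
            rw [Nat.add_sub_cancel, pow_add]
            norm_num
            ring
    have h4 : ((1 + q) ^ 2) ^ (k - 1) ≤ (9 / 8) ^ k := by
      calc ((1 + q) ^ 2) ^ (k - 1) ≤ (9 / 8) ^ (k - 1) := by
            gcongr
            nlinarith
        _ ≤ (9 / 8) ^ k := pow_le_pow_right₀ (by norm_num) (by omega)
    calc (r : ℝ) * (r * ((1 + q) / r) ^ (2 * (k - 1)))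
        = (r : ℝ)⁻¹ ^ (k - 1) * ((r : ℝ) ^ 2 * (r : ℝ)⁻¹ ^ (k - 1) * ((1 + q) ^ 2) ^ (k - 1)) := by
          rw [div_eq_mul_inv, mul_pow, pow_mul, pow_mul, pow_two (r⁻¹ : ℝ), mul_pow]
          ring
      _ ≤ (r : ℝ)⁻¹ ^ (k - 1) * (8 * 2⁻¹ ^ k * (9 / 8) ^ k) := by gcongr
      _ = _ := by rw [mul_assoc, ← mul_pow]; norm_num
  rw [le_div_iff₀ (by positivity)]
  calc 4 * ω * (4 * (r * (r * ((1 + q) / r) ^ n))) * (8 * N)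
      ≤ 4 * k * (4 * (r * (r * ((1 + q) / r) ^ (2 * (k - 1))))) * (8 * N) := by gcongr
    _ ≤ 4 * k * (4 * ((r : ℝ)⁻¹ ^ (k - 1) * (8 * (9 / 16) ^ k))) * (8 * N) := by gcongr
    _ = 1024 * k * (N * (r : ℝ)⁻¹ ^ (k - 1)) * (9 / 16) ^ k := by ring
    _ ≤ 1024 * k * k * (9 / 16) ^ k := by gcongr
    _ = 1024 * (k : ℝ) ^ 2 * (9 / 16) ^ k := by ring
    _ ≤ 1 := sq_mul_pow_le hk

lemma swap_bound (hk : 100 ≤ k) (hr : 2 ≤ r) (hN : 0 < N) (hNk : N * (r : ℝ)⁻¹ ^ (k - 1) ≤ k)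
    (hq0 : 0 ≤ q) (hq : q ≤ 1 / 24) :
    2 * (r * (r * (2 * q / (r * (r - 1))) ^ k)) ≤ 1 / (8 * N) := by
  have hr2 : (2 : ℝ) ≤ r := by exact_mod_cast hr
  have hr0 : (0 : ℝ) < r := by linarith
  have hk1 : (1 : ℝ) ≤ k := by exact_mod_cast (by omega : 1 ≤ k)
  have h1 : 2 * q / (r * (r - 1)) ≤ (9 / 16) / r / r := by
    have h0 : (0 : ℝ) < r - 1 := by linarith
    rw [div_div, div_le_div_iff₀ (by positivity) (by positivity)]
    have : 2 * q ≤ 9 / 16 * (1 / 2) := by linarith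
    calc 2 * q * (r * r) ≤ 9 / 16 * (1 / 2) * (r * r) := by gcongr
      _ ≤ 9 / 16 * (r * (r - 1)) := by nlinarith
  have h2 : (r : ℝ) * (r * ((9 / 16) / r / r) ^ k) ≤ (r : ℝ)⁻¹ ^ (k - 1) * (9 / 16) ^ k := by
    calc (r : ℝ) * (r * ((9 / 16) / r / r) ^ k)
        = (r : ℝ)⁻¹ ^ (k - 1) * ((r : ℝ)⁻¹ ^ (k - 1) * (9 / 16) ^ k) := by
          rw [mul_div_pow_eq hr0.ne' (by omega), mul_left_comm, mul_div_pow_eq hr0.ne' (by omega)]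
      _ ≤ (r : ℝ)⁻¹ ^ (k - 1) * (1 * (9 / 16) ^ k) := by
          gcongr
          exact pow_le_one₀ (by positivity) (inv_le_one_of_one_le₀ (by linarith))
      _ = _ := by rw [one_mul]
  have h3 : (0 : ℝ) ≤ 2 * q / (r * (r - 1)) := by
    have : (0 : ℝ) ≤ r - 1 := by linarith
    positivity
  rw [le_div_iff₀ (by positivity)]
  calc 2 * (r * (r * (2 * q / (r * (r - 1))) ^ k)) * (8 * N)
      ≤ 2 * (r * (r * ((9 / 16) / r / r) ^ k)) * (8 * N) := by gcongr
    _ ≤ 2 * ((r : ℝ)⁻¹ ^ (k - 1) * (9 / 16) ^ k) * (8 * N) := by gcongr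
    _ = 16 * (N * (r : ℝ)⁻¹ ^ (k - 1)) * (9 / 16) ^ k := by ring
    _ ≤ 16 * k * (9 / 16) ^ k := by gcongr
    _ ≤ 1024 * (k * k) * (9 / 16) ^ k := by
        gcongr
        · norm_num
        · exact le_mul_of_one_le_left (by linarith) hk1
    _ = 1024 * (k : ℝ) ^ 2 * (9 / 16) ^ k := by ring
    _ ≤ 1 := sq_mul_pow_le hk

lemma cover_bound {y z : ℝ} (hk : 1 ≤ k) (hN : 0 < N) (hy : 0 < y) (hz : 0 < z) (hzk : z ≤ k)
    (hNy : N * y ≤ k / z) (ht : 3 ≤ t) (hL : 24 ≤ L) (hLz : L ^ (2 * t) ≤ z)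
    (hkz : (k : ℝ) ^ 2 ≤ z ^ t) (hLk : L ^ (t ^ 2) ≤ k) (hq : q = L / k) {m w : ℕ} (hmw : m ≤ w)
    (htw : t ≤ w) :
    2 ^ (m + 1) * (y ^ (m + 1) * (4 * q) ^ w * (3 * L ^ (t - 1)) ^ m) ≤
      (1 / N) ^ m * (1 / (48 * N)) := by
  have hk0 : (0 : ℝ) < k := by exact_mod_cast hk
  have hL0 : 0 < L := by linarith
  have hL1 : 1 ≤ L := by linarith
  have hq0 : 0 ≤ q := by rw [hq]; positivity
  set B := 24 * L ^ t / z with hB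
  have hB0 : 0 < B := by positivity
  have h24 : 24 ≤ L ^ t := by
    calc (24 : ℝ) ≤ L ^ 1 := by simpa
      _ ≤ L ^ t := pow_le_pow_right₀ hL1 (by omega)
  have hB1 : B ≤ 1 := by
    rw [hB, div_le_one hz]
    calc 24 * L ^ t ≤ L ^ t * L ^ t := by gcongr
      _ = L ^ (2 * t) := by rw [two_mul, pow_add]
      _ ≤ z := hLz
  have hqB : 4 * q ≤ B := by
    rw [hq, hB, ← mul_div_assoc]
    refine div_le_div₀ (by positivity) ?_ hz hzk
    have : L ≤ L ^ t := le_self_pow₀ hL1 (by omega)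
    linarith
  have hLt : L * L ^ (t - 1) = L ^ t := by
    rw [← pow_succ']
    congr 1
    omega
  have hqy : 24 * q * y * L ^ (t - 1) ≤ B * (1 / N) := by
    rw [mul_one_div, le_div_iff₀ hN]
    calc 24 * q * y * L ^ (t - 1) * N = 24 * (L * L ^ (t - 1)) / k * (N * y) := by rw [hq]; ring
      _ ≤ 24 * (L * L ^ (t - 1)) / k * (k / z) := by gcongr
      _ = B := by
        rw [hLt, hB]
        field_simp
  have hBt : k / z * B ^ t ≤ 1 / 96 := by
    have h1 : (24 : ℝ) ^ t * 24 ^ t ≤ z := by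
      calc (24 : ℝ) ^ t * 24 ^ t ≤ L ^ t * L ^ t := by gcongr
        _ = L ^ (2 * t) := by rw [two_mul, pow_add]
        _ ≤ z := hLz
    have h2 : (24 : ℝ) ^ 3 ≤ 24 ^ t := pow_le_pow_right₀ (by norm_num) ht
    calc k / z * B ^ t = k * L ^ (t ^ 2) * (24 ^ t / z / z ^ t) := by
          rw [hB, div_pow, mul_pow, ← pow_mul, ← sq]
          ring
      _ ≤ k * k * (24 ^ t / z / k ^ 2) := by gcongr
      _ = 24 ^ t / z := by field_simp
      _ ≤ 1 / 24 ^ t := by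
          rw [div_le_div_iff₀ hz (by positivity), one_mul]
          exact h1
      _ ≤ 1 / 96 := by
          gcongr
          norm_num at h2
          linarith
  have hyB : y * B ^ t ≤ 1 / (96 * N) := by
    rw [le_div_iff₀ (by positivity)]
    calc y * B ^ t * (96 * N) = 96 * (N * y * B ^ t) := by ring
      _ ≤ 96 * (k / z * B ^ t) := by gcongr
      _ ≤ 1 := by linarith
  calc 2 ^ (m + 1) * (y ^ (m + 1) * (4 * q) ^ w * (3 * L ^ (t - 1)) ^ m)
      = 2 * y * (24 * q * y * L ^ (t - 1)) ^ m * (4 * q) ^ (w - m) := by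
        rw [← pow_mul_pow_sub (4 * q) hmw, mul_pow 3, mul_pow _ (L ^ (t - 1)), mul_pow _ y,
          mul_pow 24, mul_pow 4 q m, show (24 : ℝ) = 2 * (4 * 3) by norm_num, mul_pow 2 (4 * 3),
          mul_pow 4 3]
        ring
    _ ≤ 2 * y * (B * (1 / N)) ^ m * B ^ (w - m) := by gcongr
    _ = 2 * (1 / N) ^ m * (y * B ^ w) := by
        rw [mul_pow, ← pow_mul_pow_sub B hmw]
        ring
    _ ≤ 2 * (1 / N) ^ m * (y * B ^ t) := by
        have : B ^ w ≤ B ^ t := pow_le_pow_of_le_one hB0.le hB1 htw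
        gcongr
    _ ≤ 2 * (1 / N) ^ m * (1 / (96 * N)) := by gcongr
    _ = _ := by
        field_simp
        norm_num

end Numerics

end HG

namespace HG

open MeasureTheory ProbabilityTheory

section BadEvents

variable {V : Type*} {r t : ℕ}

lemma DeterminedBy.union {St : Type*} {A B : Set (V → St)} {S T U : Finset V}
    (hA : DeterminedBy A S) (hB : DeterminedBy B T) (hS : S ⊆ U) (hT : T ⊆ U) :
    DeterminedBy (A ∪ B) U := by
  rintro x y hxy (h | h)
  · exact Or.inl (hA x y (fun v hv => hxy v (hS hv)) h)
  · exact Or.inr (hB x y (fun v hv => hxy v (hT hv)) h)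

lemma determinedBy_empty {St : Type*} (T : Finset V) : DeterminedBy (∅ : Set (V → St)) T :=
  fun _ _ _ h => h

variable [DecidableEq V]

/-- Edges lying in a common triangle with `e`. -/
noncomputable def triLinks (E : Finset (Finset V)) (e : Finset V) : Finset (Finset V) :=
  E.filter fun f => ∃ f' ∈ E, IsTriangle e f f'

lemma mem_triLinks_comm {E : Finset (Finset V)} {e f : Finset V} (he : e ∈ E)
    (h : f ∈ triLinks E e) : e ∈ triLinks E f := by
  obtain ⟨-, f', hf', h1, h2, h3, h4, h5, h6⟩ := Finset.mem_filter.1 h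
  refine Finset.mem_filter.2 ⟨he, f', hf', h1.symm, h3, h2, ?_, h6, h5⟩
  rwa [Finset.inter_comm]

lemma card_triLinks_le (E : Finset (Finset V)) (e : Finset V) :
    (triLinks E e).card ≤ 2 * triCount E e := by
  set P := (E.powersetCard 2).filter fun s => ∃ f ∈ s, ∃ h ∈ s, f ≠ h ∧ IsTriangle e f h with hP
  have hsub : triLinks E e ⊆ P.biUnion id := by
    intro f hf
    obtain ⟨hfE, f', hf', h⟩ := Finset.mem_filter.1 hf
    have hff : f ≠ f' := h.2.2.1
    refine Finset.mem_biUnion.2 ⟨{f, f'}, Finset.mem_filter.2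
      ⟨Finset.mem_powersetCard.2 ⟨?_, Finset.card_pair hff⟩, f, ?_, f', ?_, hff, h⟩, ?_⟩
    · rw [Finset.insert_subset_iff, Finset.singleton_subset_iff]
      exact ⟨hfE, hf'⟩
    all_goals simp
  calc (triLinks E e).card ≤ (P.biUnion id).card := Finset.card_le_card hsub
    _ ≤ P.card * 2 := Finset.card_biUnion_le_card_mul _ _ _ fun s hs =>
        (Finset.mem_powersetCard.1 (Finset.mem_filter.1 hs).1).2.le
    _ = 2 * triCount E e := by
        rw [mul_comm]
        rfl

lemma mem_neighbors_comm {E : Finset (Finset V)} {e f : Finset V} (he : e ∈ E)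
    (h : f ∈ neighbors E e) : e ∈ neighbors E f := by
  rw [mem_neighbors] at h ⊢
  exact ⟨h.1.symm, he, Finset.inter_comm e f ▸ h.2.2⟩

lemma sum_powerset_pow_card {α : Type*} [DecidableEq α] (S : Finset α) (p : ℝ) :
    ∑ F ∈ S.powerset, p ^ F.card = (p + 1) ^ S.card := by
  rw [← Finset.sum_pow_mul_eq_add_pow]
  simp

lemma sum_powerset_mem_pow_card_le {α : Type*} [DecidableEq α] (S : Finset α) (a : α) {p : ℝ}
    (hp : 0 ≤ p) :
    ∑ F ∈ S.powerset with a ∈ F, p ^ F.card ≤ p * (p + 1) ^ S.card := by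
  have hinj : Set.InjOn (fun F : Finset α => F.erase a)
      (S.powerset.filter fun F => a ∈ F : Finset (Finset α)) := by
    intro F hF F' hF' h
    rw [← Finset.insert_erase (Finset.mem_filter.1 (Finset.mem_coe.1 hF)).2,
      ← Finset.insert_erase (Finset.mem_filter.1 (Finset.mem_coe.1 hF')).2]
    exact congrArg _ h
  calc ∑ F ∈ S.powerset with a ∈ F, p ^ F.card
      = ∑ F ∈ S.powerset with a ∈ F, p * p ^ (F.erase a).card := by
        refine Finset.sum_congr rfl fun F hF => ?_
        rw [← pow_succ', Finset.card_erase_add_one (Finset.mem_filter.1 hF).2]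
    _ = p * ∑ F ∈ (S.powerset.filter fun F => a ∈ F).image (fun F => F.erase a), p ^ F.card := by
        rw [Finset.sum_image hinj, Finset.mul_sum]
    _ ≤ p * ∑ F ∈ S.powerset, p ^ F.card := by
        refine mul_le_mul_of_nonneg_left (Finset.sum_le_sum_of_subset_of_nonneg ?_
          fun F _ _ => by positivity) hp
        intro F hF
        obtain ⟨G, hG, rfl⟩ := Finset.mem_image.1 hF
        exact Finset.mem_powerset.2 ((Finset.erase_subset _ _).trans
          (Finset.mem_powerset.1 (Finset.mem_filter.1 hG).1))
    _ = _ := by rw [sum_powerset_pow_card]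

/-- The bad events attached to the edge `e` and the family `F`. -/
def badEvent (r t : ℕ) (E : Finset (Finset V)) (e : Finset V) (F : Finset (Finset V)) :
    Set (V → Fin r × Fin r) :=
  (if F = ∅ then stuckEvent r t e ∪ swapEvent r e else ∅) ∪
    ((if ∃ f ∈ triLinks E e, F = {f} then doubleEvent r e (F.biUnion id) else ∅) ∪
      if F ⊆ neighbors E e ∧ IsFlower t e F then coverEvent r t e F else ∅)

lemma determinedBy_badEvent (E : Finset (Finset V)) (e : Finset V) (F : Finset (Finset V)) :
    DeterminedBy (badEvent r t E e F) ((insert e F).biUnion id) := by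
  have h : (insert e F).biUnion id = e ∪ F.biUnion id := Finset.biUnion_insert
  rw [h]
  refine DeterminedBy.union (S := e) (T := e ∪ F.biUnion id) ?_
    (DeterminedBy.union (S := e ∪ F.biUnion id) (T := e ∪ F.biUnion id) ?_ ?_ subset_rfl subset_rfl)
    Finset.subset_union_left subset_rfl
  · split_ifs
    · exact (determinedBy_stuckEvent t e).union (determinedBy_swapEvent e) subset_rfl subset_rfl
    · exact determinedBy_empty _
  · split_ifs
    · exact determinedBy_doubleEvent _ _
    · exact determinedBy_empty _
  · split_ifs
    · exact determinedBy_coverEvent _ _ _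
    · exact determinedBy_empty _

/-- The form of the bounds on the probabilities of the bad events. -/
noncomputable def badBound (E : Finset (Finset V)) (a c s p : ℝ) (e : Finset V)
    (F : Finset (Finset V)) : ℝ :=
  (if F = ∅ then a else 0) + ((if ∃ f ∈ triLinks E e, F = {f} then c else 0) +
    if F ⊆ neighbors E e then p ^ F.card * s else 0)

lemma measureReal_ite_empty_mul_le {Ω : Type*} [MeasurableSpace Ω] (μ : Measure Ω) (P : Prop)
    [Decidable P] (A : Set Ω) {x y : ℝ} (h : P → μ.real A * x ≤ y) :
    μ.real (if P then A else ∅) * x ≤ if P then y else 0 := by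
  split_ifs with hP
  · exact h hP
  · simp

lemma real_badEvent_mul_le {ν : Measure (Fin r × Fin r)} [IsProbabilityMeasure ν]
    {E : Finset (Finset V)} {a₁ a₂ c s p : ℝ} {e : Finset V} {F : Finset (Finset V)} (hs : 0 ≤ s)
    (hp : 0 ≤ p)
    (hstuck : 2 * (Measure.infinitePi fun _ : V => ν).real (stuckEvent r t e) ≤ a₁)
    (hswap : 2 * (Measure.infinitePi fun _ : V => ν).real (swapEvent r e) ≤ a₂)
    (hdouble : ∀ f ∈ triLinks E e,
      4 * (Measure.infinitePi fun _ : V => ν).real (doubleEvent r e f) ≤ c)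
    (hcover : F ⊆ neighbors E e → IsFlower t e F →
      2 ^ (F.card + 1) * (Measure.infinitePi fun _ : V => ν).real (coverEvent r t e F) ≤
        p ^ F.card * s) :
    (Measure.infinitePi fun _ : V => ν).real (badEvent r t E e F) * 2 ^ (insert e F).card ≤
      badBound E (a₁ + a₂) c s p e F := by
  set μ := Measure.infinitePi fun _ : V => ν with hμ
  have hcard : (2 : ℝ) ^ (insert e F).card ≤ 2 ^ (F.card + 1) :=
    pow_le_pow_right₀ one_le_two (Finset.card_insert_le _ _)
  have h1 : μ.real (if F = ∅ then stuckEvent r t e ∪ swapEvent r e else ∅) *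
      2 ^ (insert e F).card ≤ if F = ∅ then a₁ + a₂ else 0 := by
    refine measureReal_ite_empty_mul_le _ _ _ fun hF => ?_
    have := measureReal_union_le (μ := μ) (stuckEvent r t e) (swapEvent r e)
    subst hF
    simp only [insert_empty_eq, Finset.card_singleton, pow_one]
    linarith
  have h2 : μ.real (if ∃ f ∈ triLinks E e, F = {f} then doubleEvent r e (F.biUnion id) else ∅) *
      2 ^ (insert e F).card ≤ if ∃ f ∈ triLinks E e, F = {f} then c else 0 := by
    refine measureReal_ite_empty_mul_le _ _ _ ?_
    rintro ⟨f, hf, rfl⟩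
    rw [Finset.singleton_biUnion, id]
    refine le_trans ?_ (hdouble f hf)
    rw [mul_comm 4]
    refine mul_le_mul_of_nonneg_left (hcard.trans ?_) measureReal_nonneg
    norm_num
  have h3 : μ.real (if F ⊆ neighbors E e ∧ IsFlower t e F then coverEvent r t e F else ∅) *
      2 ^ (insert e F).card ≤ if F ⊆ neighbors E e then p ^ F.card * s else 0 := by
    refine (measureReal_ite_empty_mul_le _ _ _ (y := p ^ F.card * s) fun hF => ?_).trans ?_
    · refine le_trans ?_ (hcover hF.1 hF.2)
      rw [mul_comm (2 ^ (F.card + 1))]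
      exact mul_le_mul_of_nonneg_left hcard measureReal_nonneg
    · by_cases hF : F ⊆ neighbors E e
      · rw [if_pos hF]
        split_ifs
        · exact le_rfl
        · positivity
      · simp [hF]
  calc _ ≤ (μ.real (if F = ∅ then stuckEvent r t e ∪ swapEvent r e else ∅) +
        (μ.real (if ∃ f ∈ triLinks E e, F = {f} then doubleEvent r e (F.biUnion id) else ∅) +
        μ.real (if F ⊆ neighbors E e ∧ IsFlower t e F then coverEvent r t e F else ∅))) *
        2 ^ (insert e F).card := by
        refine mul_le_mul_of_nonneg_right ?_ (by positivity)
        exact (measureReal_union_le _ _).trans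
          (add_le_add_right (measureReal_union_le _ _) _)
    _ ≤ _ := by
        rw [add_mul, add_mul, badBound]
        exact add_le_add h1 (add_le_add h2 h3)

lemma sum_flowers_le (E : Finset (Finset V)) {N : ℕ} (hN : 0 < N)
    (hdeg : ∀ e ∈ E, (neighbors E e).card ≤ N) {g : Finset V} (hg : g ∈ E) :
    ∑ i ∈ E ×ˢ E.powerset with g ∈ insert i.1 i.2,
      (if i.2 ⊆ neighbors E i.1 then (1 / (N : ℝ)) ^ i.2.card else 0) ≤ 6 := by
  set p : ℝ := 1 / N with hp
  have hN0 : (0 : ℝ) < N := by exact_mod_cast hN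
  have hp0 : 0 ≤ p := by positivity
  have h3 : ∀ e ∈ E, (p + 1) ^ (neighbors E e).card ≤ 3 := by
    intro e he
    rw [add_comm, hp]
    simpa using one_add_one_div_pow_le (m := 1) hN (by simpa using hdeg e he)
  have hnsub : ∀ e, neighbors E e ⊆ E := fun e f hf => (mem_neighbors.1 hf).2.1
  have hsub : ((E ×ˢ E.powerset).filter fun i => g ∈ insert i.1 i.2).filter
      (fun i => i.2 ⊆ neighbors E i.1) ⊆
      ((neighbors E g).powerset.image fun F => (g, F)) ∪
      (neighbors E g).biUnion fun e =>
        ((neighbors E e).powerset.filter fun F => g ∈ F).image fun F => (e, F) := by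
    rintro ⟨e, F⟩ h
    simp only [Finset.mem_filter, Finset.mem_product, Finset.mem_powerset,
      Finset.mem_insert] at h
    obtain ⟨⟨⟨he, -⟩, h⟩, hF⟩ := h
    rcases h with rfl | h
    · exact Finset.mem_union_left _ (Finset.mem_image.2 ⟨F, Finset.mem_powerset.2 hF, rfl⟩)
    · exact Finset.mem_union_right _ (Finset.mem_biUnion.2 ⟨e, mem_neighbors_comm he (hF h),
        Finset.mem_image.2 ⟨F, Finset.mem_filter.2 ⟨Finset.mem_powerset.2 hF, h⟩, rfl⟩⟩)
  have hnn : ∀ i : Finset V × Finset (Finset V), 0 ≤ p ^ i.2.card := fun i => by positivity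
  rw [← Finset.sum_filter]
  calc _ ≤ _ := Finset.sum_le_sum_of_subset_of_nonneg hsub fun i _ _ => hnn i
    _ ≤ ∑ i ∈ (neighbors E g).powerset.image (fun F => (g, F)), p ^ i.2.card +
        ∑ i ∈ (neighbors E g).biUnion fun e =>
          ((neighbors E e).powerset.filter fun F => g ∈ F).image fun F => (e, F),
          p ^ i.2.card := by
        rw [← Finset.sum_union_inter]
        exact le_add_of_nonneg_right (Finset.sum_nonneg fun i _ => hnn i)
    _ ≤ 3 + 3 := by
        refine add_le_add ?_ ?_
        · rw [Finset.sum_image fun F _ F' _ h => (Prod.mk.injEq _ _ _ _ ▸ h).2]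
          simp only
          rw [sum_powerset_pow_card]
          exact h3 g hg
        · rw [Finset.sum_biUnion]
          · calc _ ≤ ∑ e ∈ neighbors E g, p * 3 := by
                  refine Finset.sum_le_sum fun e he => ?_
                  rw [Finset.sum_image fun F _ F' _ h => (Prod.mk.injEq _ _ _ _ ▸ h).2]
                  refine (sum_powerset_mem_pow_card_le _ _ hp0).trans ?_
                  exact mul_le_mul_of_nonneg_left (h3 e (hnsub g he)) hp0
              _ = (neighbors E g).card * p * 3 := by
                  rw [Finset.sum_const, nsmul_eq_mul, mul_assoc]
              _ ≤ N * p * 3 := by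
                  have : ((neighbors E g).card : ℝ) ≤ N := by exact_mod_cast hdeg g hg
                  gcongr
              _ = 3 := by rw [hp, mul_one_div_cancel hN0.ne', one_mul]
          · intro e _ e' _ hee
            rw [Function.onFun, Finset.disjoint_left]
            intro i hi hi'
            obtain ⟨F, -, rfl⟩ := Finset.mem_image.1 hi
            obtain ⟨F', -, h⟩ := Finset.mem_image.1 hi'
            exact hee (congrArg Prod.fst h).symm
    _ = 6 := by norm_num

lemma card_triLink_pairs_le (E : Finset (Finset V)) {ω : ℕ} (htri : ∀ e ∈ E, triCount E e ≤ ω)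
    {g : Finset V} (hg : g ∈ E) :
    (((E ×ˢ E.powerset).filter fun i => g ∈ insert i.1 i.2).filter
      fun i => ∃ f ∈ triLinks E i.1, i.2 = {f}).card ≤ 4 * ω := by
  have hsub : ((E ×ˢ E.powerset).filter fun i => g ∈ insert i.1 i.2).filter
      (fun i => ∃ f ∈ triLinks E i.1, i.2 = {f}) ⊆
      (triLinks E g).image (fun f => (g, {f})) ∪ (triLinks E g).image fun e => (e, {g}) := by
    rintro ⟨e, F⟩ h
    simp only [Finset.mem_filter, Finset.mem_product, Finset.mem_insert] at h
    obtain ⟨⟨⟨he, -⟩, h⟩, f, hf, rfl⟩ := h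
    rcases h with rfl | h
    · exact Finset.mem_union_left _ (Finset.mem_image.2 ⟨f, hf, rfl⟩)
    · rw [Finset.mem_singleton] at h
      subst h
      exact Finset.mem_union_right _ (Finset.mem_image.2 ⟨e, mem_triLinks_comm he hf, rfl⟩)
  have hT := (card_triLinks_le E g).trans (Nat.mul_le_mul_left 2 (htri g hg))
  calc _ ≤ _ := Finset.card_le_card hsub
    _ ≤ _ := Finset.card_union_le _ _
    _ ≤ (triLinks E g).card + (triLinks E g).card :=
      add_le_add Finset.card_image_le Finset.card_image_le
    _ ≤ 4 * ω := by omega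

lemma sum_badBound_le (E : Finset (Finset V)) {N ω : ℕ} (hN : 0 < N)
    (hdeg : ∀ e ∈ E, (neighbors E e).card ≤ N) (htri : ∀ e ∈ E, triCount E e ≤ ω)
    {a c s : ℝ} (ha : 0 ≤ a) (hc : 0 ≤ c) (hs : 0 ≤ s) {g : Finset V} (hg : g ∈ E) :
    ∑ i ∈ E ×ˢ E.powerset with g ∈ insert i.1 i.2, badBound E a c s (1 / N) i.1 i.2 ≤
      a + (4 * ω * c + 6 * s) := by
  simp only [badBound]
  rw [Finset.sum_add_distrib, Finset.sum_add_distrib]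
  refine add_le_add ?_ (add_le_add ?_ ?_)
  · rw [← Finset.sum_filter, Finset.sum_const, nsmul_eq_mul]
    refine mul_le_of_le_one_left ha ?_
    have hsub : ((E ×ˢ E.powerset).filter fun i => g ∈ insert i.1 i.2).filter
        (fun i => i.2 = ∅) ⊆ {(g, ∅)} := by
      rintro ⟨e, F⟩ h
      simp only [Finset.mem_filter] at h
      obtain ⟨⟨-, h⟩, rfl⟩ := h
      simp_all
    exact_mod_cast Finset.card_le_card hsub
  · rw [← Finset.sum_filter, Finset.sum_const, nsmul_eq_mul]
    refine mul_le_mul_of_nonneg_right ?_ hc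
    exact_mod_cast card_triLink_pairs_le E htri hg
  · calc _ = (∑ i ∈ E ×ˢ E.powerset with g ∈ insert i.1 i.2,
          if i.2 ⊆ neighbors E i.1 then (1 / (N : ℝ)) ^ i.2.card else 0) * s := by
          rw [Finset.sum_mul]
          exact Finset.sum_congr rfl fun i _ => by rw [ite_mul, zero_mul]
      _ ≤ 6 * s := mul_le_mul_of_nonneg_right (sum_flowers_le E hN hdeg hg) hs

end BadEvents

end HG

namespace HG

open MeasureTheory ProbabilityTheory

variable {V : Type*} [DecidableEq V]

lemma card_filter_inter_nonempty_le (E : Finset (Finset V)) {d : ℕ} {e : Finset V}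
    (hdeg : (neighbors E e).card ≤ d) : (E.filter fun f => (e ∩ f).Nonempty).card ≤ d + 1 := by
  have hsub : (E.filter fun f => (e ∩ f).Nonempty) ⊆ insert e (neighbors E e) := by
    intro f hf
    rw [Finset.mem_filter] at hf
    rw [Finset.mem_insert, mem_neighbors]
    by_cases h : f = e
    · exact Or.inl h
    · exact Or.inr ⟨h, hf⟩
  exact (Finset.card_le_card hsub).trans ((Finset.card_insert_le _ _).trans (by omega))

/-- A hypergraph is `r`-colorable if the sums of the bounds of the probabilities of the bad events
are small. -/
theorem rColorable_of_real_le {r t d ω : ℕ} (E : Finset (Finset V)) (hne : ∀ e ∈ E, e.Nonempty)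
    (hsimple : TwoSimple E) (htri : ∀ e ∈ E, triCount E e ≤ ω)
    (hdeg : ∀ e ∈ E, (neighbors E e).card ≤ d)
    (ν : Measure (Fin r × Fin r)) [IsProbabilityMeasure ν] {a₁ a₂ c s : ℝ}
    (ha₁ : 0 ≤ a₁) (ha₂ : 0 ≤ a₂) (hc : 0 ≤ c) (hs : 0 ≤ s)
    (hstuck : ∀ e ∈ E, 2 * (Measure.infinitePi fun _ : V => ν).real (stuckEvent r t e) ≤ a₁)
    (hswap : ∀ e ∈ E, 2 * (Measure.infinitePi fun _ : V => ν).real (swapEvent r e) ≤ a₂)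
    (hdouble : ∀ e ∈ E, ∀ f ∈ triLinks E e,
      4 * (Measure.infinitePi fun _ : V => ν).real (doubleEvent r e f) ≤ c)
    (hcover : ∀ e ∈ E, ∀ F ⊆ neighbors E e, IsFlower t e F →
      2 ^ (F.card + 1) * (Measure.infinitePi fun _ : V => ν).real (coverEvent r t e F) ≤
        (1 / ((d + 1 : ℕ) : ℝ)) ^ F.card * s)
    (hsum : a₁ + a₂ + (4 * ω * c + 6 * s) ≤ 1 / (2 * ((d + 1 : ℕ) : ℝ))) :
    RColorable r E := by
  obtain ⟨x, hx⟩ := exists_avoiding ν E (E ×ˢ E.powerset) (fun i => insert i.1 i.2)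
    (fun i => badEvent r t E i.1 i.2) (d + 1) (Nat.succ_pos d)
    (fun i _ => determinedBy_badEvent E i.1 i.2) (fun i _ => Finset.insert_nonempty _ _)
    (fun i hi => Finset.insert_subset (Finset.mem_product.1 hi).1
      (Finset.mem_powerset.1 (Finset.mem_product.1 hi).2))
    (fun e he => card_filter_inter_nonempty_le E (hdeg e he)) (by
      intro g hg
      refine le_trans (Finset.sum_le_sum fun i hi => ?_) ((sum_badBound_le E (Nat.succ_pos d)
        (fun e he => (hdeg e he).trans (Nat.le_succ d)) htri (add_nonneg ha₁ ha₂) hc hs hg).trans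
          hsum)
      have he := (Finset.mem_product.1 (Finset.mem_filter.1 hi).1).1
      exact real_badEvent_mul_le hs (by positivity) (hstuck _ he) (hswap _ he) (hdouble _ he)
        (hcover _ he _))
  have hnot : ∀ e ∈ E, ∀ F ⊆ E, x ∉ badEvent r t E e F := fun e he F hF =>
    hx (e, F) (Finset.mem_product.2 ⟨he, Finset.mem_powerset.2 hF⟩)
  refine rColorable_of_notMem E hne hsimple x (t := t) (fun e he h => ?_) (fun e he h => ?_)
    (fun e he f hf hff h => ?_) fun e he F hF hflower h => ?_
  · refine hnot e he ∅ (Finset.empty_subset _) (Or.inl ?_)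
    rw [if_pos rfl]
    exact Or.inl h
  · refine hnot e he ∅ (Finset.empty_subset _) (Or.inl ?_)
    rw [if_pos rfl]
    exact Or.inr h
  · refine hnot e he {f} (Finset.singleton_subset_iff.2 hf) (Or.inr (Or.inl ?_))
    rw [if_pos ⟨f, Finset.mem_filter.2 ⟨hf, hff⟩, rfl⟩, Finset.singleton_biUnion]
    exact h
  · refine hnot e he F (fun f hf => (mem_neighbors.1 (hF hf)).2.1) (Or.inr (Or.inr ?_))
    rw [if_pos ⟨hF, hflower⟩]
    exact h

end HG

/-- the multiparametric theorem. Let `k ≥ 3`, `r ≥ 2`, `ω ≥ 1` be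
integers and `b, α` positive reals; set `t = ⌊√(ln k / ln(α ln k))⌋` and
`q = (α ln k)/k`. Let `H` be a `k`-uniform 2-simple hypergraph in which every
edge lies in at most `ω` 3-cycles, and every edge intersects at most `d` other
edges where `d ≤ r^(k−1) k^(1−b/t) − 1`. If `b ≤ t < k − ω`, `2/k ≤ q ≤ 1/2`,
and the displayed quantity is `< 1/4`, then `χ(H) ≤ r`. -/
theorem stmt7 {V : Type*} [DecidableEq V] (k r ω : ℕ) (b α : ℝ) (t : ℕ) (q : ℝ)
    (hk : 3 ≤ k) (hr : 2 ≤ r) (hω : 1 ≤ ω) (hb : 0 < b) (hα : 0 < α)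
    (ht : t = ⌊Real.sqrt (Real.log k / Real.log (α * Real.log k))⌋₊)
    (hq : q = α * Real.log k / k)
    (E : Finset (Finset V)) (huniform : ∀ e ∈ E, e.card = k)
    (hsimple : HG.TwoSimple E) (htri : ∀ e ∈ E, HG.triCount E e ≤ ω)
    (d : ℕ)
    (hdeg : ∀ e ∈ E, ((E.erase e).filter fun f => (e ∩ f).Nonempty).card ≤ d)
    (hd : (d : ℝ) ≤ (r : ℝ) ^ (k - 1) * (k : ℝ) ^ ((1 : ℝ) - b / t) - 1)
    (hbt : b ≤ (t : ℝ)) (htk : t + ω < k)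
    (hq1 : 2 / (k : ℝ) ≤ q) (hq2 : q ≤ 1 / 2)
    (hmain : (k : ℝ) ^ 2 / 2 ^ k
        + ((t : ℝ) + 1) * (k : ℝ) ^ ((1 : ℝ) - α) *
          Real.exp (α * Real.log k * ((t : ℝ) + (ω : ℝ)) / k) *
          (α * Real.log k) ^ (t + ω)
        + (((t : ℝ) + 1) ^ 2 / (t.factorial : ℝ)) * (k : ℝ) ^ ((2 : ℝ) - b) *
          (α * Real.log k) ^ (t * ω)
        + ((t : ℝ) + 1) * (t : ℝ) *
          ((2 * Real.exp 1 * α * Real.log k) / ((t : ℝ) - 1)) ^ (t - 1) *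
          (k : ℝ) ^ ((1 : ℝ) + α - b)
        < 1 / 4) :
    HG.RColorable r E := by
  set L := α * Real.log k with hL
  have hk0 : (0 : ℝ) < k := by positivity
  have hk1 : (1 : ℝ) ≤ k := by exact_mod_cast (by omega : 1 ≤ k)
  have hL2 : 2 ≤ L := by
    rw [hq, div_le_div_iff_of_pos_right hk0] at hq1
    exact hq1
  rw [mul_assoc (2 * Real.exp 1) α, ← hL] at hmain
  obtain ⟨ht3, hb2, hL24, hpow, hterm⟩ := HG.parameter_bounds hk hb hL hL2 ht hbt hmain
  have hL1 : 1 ≤ L := by linarith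
  have ht0 : (0 : ℝ) < t := by exact_mod_cast (by omega : 0 < t)
  have hpow9 := HG.le_pow_nine_of_pow_sq_le ht3 hL24 hpow
  have hk100 := HG.hundred_le_of_pow_nine_le hL24 hpow9
  have hq24 : q ≤ 1 / 24 := hq ▸ HG.div_le_of_pow_nine_le hL24 hpow9
  have hq0 : 0 ≤ q := by rw [hq]; positivity
  have hr0 : (0 : ℝ) < r := by positivity
  have hN : (0 : ℝ) < ((d + 1 : ℕ) : ℝ) := by positivity
  set z := (k : ℝ) ^ (b / t) with hz
  have hz0 : 0 < z := by positivity
  have hz1 : 1 ≤ z := Real.one_le_rpow hk1 (by positivity)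
  have hzk : z ≤ k := by
    calc z ≤ (k : ℝ) ^ (1 : ℝ) := by
          rw [hz]
          gcongr
          rwa [div_le_one ht0]
      _ = k := Real.rpow_one _
  have hkz : (k : ℝ) ^ 2 ≤ z ^ t := by
    rw [hz, ← Real.rpow_natCast, ← Real.rpow_natCast, ← Real.rpow_mul hk0.le,
      div_mul_cancel₀ _ ht0.ne']
    gcongr
    exact_mod_cast hb2
  have hNz : ((d + 1 : ℕ) : ℝ) * (r : ℝ)⁻¹ ^ (k - 1) ≤ k / z := by
    have h1 : ((d + 1 : ℕ) : ℝ) ≤ (r : ℝ) ^ (k - 1) * (k / z) := by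
      rw [Real.rpow_sub hk0, Real.rpow_one] at hd
      push_cast
      linarith
    rwa [inv_pow, ← div_eq_mul_inv, div_le_iff₀ (by positivity), mul_comm]
  have hNk : ((d + 1 : ℕ) : ℝ) * (r : ℝ)⁻¹ ^ (k - 1) ≤ k :=
    hNz.trans (div_le_self hk0.le hz1)
  have hLz := HG.pow_two_mul_le_rpow hk1 (by omega) hb2 hL1 hpow
  obtain ⟨ν, hνp, hν⟩ := HG.exists_stateMeasure (q := q) hr hq0 (by linarith)
  have hne : ∀ e ∈ E, e.Nonempty := fun e he => Finset.card_pos.1 (by rw [huniform e he]; omega)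
  have hqL : q * L⁻¹ = 1 / k := by
    rw [hq]
    field_simp
  have hω0 : (0 : ℝ) < ω := by exact_mod_cast hω
  refine HG.rColorable_of_real_le (t := t) (ω := ω) E hne hsimple htri hdeg ν
    (a₁ := 1 / (8 * ((d + 1 : ℕ) : ℝ))) (a₂ := 1 / (8 * ((d + 1 : ℕ) : ℝ)))
    (c := 1 / (8 * ((d + 1 : ℕ) : ℝ)) / (4 * ω)) (s := 1 / (48 * ((d + 1 : ℕ) : ℝ)))
    (by positivity) (by positivity) (by positivity) (by positivity) (fun e he => ?_)
    (fun e he => ?_) (fun e he f hf => ?_) (fun e he F hF hflower => ?_) ?_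
  · refine le_trans ?_ (HG.stuck_bound hk hr hN hNk ht3 hL24 hL hq (by linarith) hterm)
    have := HG.real_stuckEvent_le hr hL1 hν t e
    rw [huniform e he] at this
    linarith
  · refine le_trans ?_ (HG.swap_bound hk100 hr hN hNk hq0 hq24)
    have := HG.real_swapEvent_le hr hq0 hν e
    rw [huniform e he] at this
    linarith
  · obtain ⟨hfE, f', -, hef, -⟩ := Finset.mem_filter.1 hf
    have hcard : 2 * k - 2 ≤ (e ∪ f).card := by
      have h1 := Finset.card_union_add_card_inter e f
      have h2 := hsimple e he f hfE hef
      have h3 := huniform e he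
      have h4 := huniform f hfE
      omega
    rw [le_div_iff₀ (by positivity), mul_comm]
    refine le_trans ?_ (HG.double_bound hk100 hr hN hNk (by omega : ω ≤ k) hq0 hq24 hcard)
    gcongr
    exact HG.real_doubleEvent_le hr hν e f
  · have : Nonempty V := ⟨(hne e he).choose⟩
    refine le_trans ?_ (HG.cover_bound (by omega) hN (pow_pos (inv_pos.2 hr0) (k - 1)) hz0 hzk hNz
      ht3 hL24 hLz hkz hpow hq hflower.card_le hflower.le_card)
    rw [← pow_mul]
    gcongr
    exact HG.real_coverEvent_le hr hL1 hq0 hν hflower (by omega) (huniform e he)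
      (fun f hf => huniform f (HG.mem_neighbors.1 (hF hf)).2.1) hqL
  · apply le_of_eq
    field_simp
    norm_num
end

section
/- Let H = (V,E) be a 2-simple k-uniform hypergraph with a fixed linear order on V, let e ∈ E, and let F = {f₁, …, f_{t−1}} be a set of edges of H all distinct from e such that each f_i intersects e, the sets f_i \ e are pairwise disjoint, and the least vertices of the sets f_i ∩ e are pairwise distinct. Let H₁, …, H_l be the connected components of the hypergraph (V, F), and for each component H_j define the graph G_j with vertex set e ∩ V(H_j) and edge set {f ∩ e : f is an edge of H_j with |f ∩ e| = 2}. Then for every j = 1, …, l, the graph G_j is either a tree or a single isolated vertex. -/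
open Finset Filter

open scoped Classical

/-- A graph on a linear order in which every vertex has at most one larger neighbour is acyclic. -/
theorem SimpleGraph.isAcyclic_of_unique_larger_neighbor {V : Type*} [LinearOrder V]
    (G : SimpleGraph V)
    (h : ∀ a b c, a < b → a < c → G.Adj a b → G.Adj a c → b = c) : G.IsAcyclic := by
  intro v c hc
  obtain ⟨m, hm, hmin⟩ := c.support.toFinset.exists_min_image id
    ⟨v, List.mem_toFinset.2 c.start_mem_support⟩
  rw [List.mem_toFinset] at hm
  have hr := hc.rotate hm
  have hle : ∀ x ∈ (c.rotate m hm).support, m ≤ x := fun x hx =>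
    hmin x (List.mem_toFinset.2 ((c.mem_support_rotate_iff m hm).1 hx))
  have hs := (c.rotate m hm).adj_snd hr.not_nil
  have hp := ((c.rotate m hm).adj_penultimate hr.not_nil).symm
  exact hr.snd_ne_penultimate (h m _ _
    (lt_of_le_of_ne (hle _ (SimpleGraph.Walk.getVert_mem_support _ _)) hs.ne)
    (lt_of_le_of_ne (hle _ (SimpleGraph.Walk.getVert_mem_support _ _)) hp.ne) hs hp)

/-- Let `H = (V,E)` be a 2-simple `k`-uniform hypergraph with a
linear order on `V`, `e ∈ E`, and `F` a set of edges distinct from `e`, each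
meeting `e`, with the sets `f \ e` pairwise disjoint and the least vertices of
the sets `f ∩ e` pairwise distinct. Then for every connected component `C` of
the hypergraph `(V, F)`, the graph with vertex set `e ∩ V(C)` and edges
`{f ∩ e : f ∈ C, |f ∩ e| = 2}` is a tree or a single isolated vertex. -/
theorem stmt9 {V : Type*} [LinearOrder V] (k : ℕ)
    (E : Finset (Finset V)) (huniform : ∀ e ∈ E, e.card = k)
    (hsimple : HG.TwoSimple E)
    (e : Finset V) (he : e ∈ E)
    (F : Finset (Finset V)) (hFE : F ⊆ E) (heF : e ∉ F)
    (hint : ∀ f ∈ F, (f ∩ e).Nonempty)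
    (hdisj : ∀ f ∈ F, ∀ g ∈ F, f ≠ g → (f \ e) ∩ (g \ e) = ∅)
    (hmin : ∀ f ∈ F, ∀ g ∈ F, f ≠ g → (f ∩ e).min ≠ (g ∩ e).min)
    -- `C` is a connected component of the hypergraph `(V, F)`:
    (C : Finset (Finset V)) (hCF : C ⊆ F) (hCne : C.Nonempty)
    (hconn : ∀ f ∈ C, ∀ g ∈ C, Relation.ReflTransGen
      (fun a b : Finset V => a ∈ C ∧ b ∈ C ∧ (a ∩ b).Nonempty) f g)
    (hmax : ∀ f ∈ C, ∀ g ∈ F, (f ∩ g).Nonempty → g ∈ C) :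
    ((SimpleGraph.fromRel fun a b : V => ∃ f ∈ C, f ∩ e = {a, b}).induce
        (↑(e ∩ C.biUnion id) : Set V)).IsTree ∨
      ∃ v, e ∩ C.biUnion id = {v} := by
  left
  set G := SimpleGraph.fromRel fun a b : V => ∃ f ∈ C, f ∩ e = {a, b} with hG
  have hadj : ∀ a b, G.Adj a b ↔ a ≠ b ∧ ∃ f ∈ C, f ∩ e = {a, b} := by
    intro a b
    rw [hG, SimpleGraph.fromRel_adj]
    simp only [Finset.pair_comm b a, or_self]
  have hmem : ∀ f ∈ C, ∀ x ∈ f ∩ e, x ∈ (↑(e ∩ C.biUnion id) : Set V) := by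
    intro f hf x hx
    rw [Finset.mem_inter] at hx
    simpa using ⟨hx.2, f, hf, hx.1⟩
  have hacyc : G.IsAcyclic := by
    refine G.isAcyclic_of_unique_larger_neighbor fun a b c hab hac h1 h2 => ?_
    obtain ⟨-, f, hf, hfe⟩ := (hadj a b).1 h1
    obtain ⟨-, g, hg, hge⟩ := (hadj a c).1 h2
    have pair_min : ∀ d, a < d → ({a, d} : Finset V).min = a := by
      intro d hd
      rw [Finset.min_insert, Finset.min_singleton]
      exact min_eq_left (WithTop.coe_le_coe.2 hd.le)
    have hfg : f = g := by
      by_contra hne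
      exact hmin f (hCF hf) g (hCF hg) hne (by rw [hfe, hge, pair_min b hab, pair_min c hac])
    subst hfg
    have hb : b ∈ ({a, c} : Finset V) := by rw [← hge, hfe]; simp
    simpa [hab.ne'] using hb
  have hedge : ∀ f (hf : f ∈ C) x (hx : x ∈ f ∩ e) y (hy : y ∈ f ∩ e),
      (G.induce (↑(e ∩ C.biUnion id) : Set V)).Reachable
        ⟨x, hmem f hf x hx⟩ ⟨y, hmem f hf y hy⟩ := by
    intro f hf x hx y hy
    by_cases hxy : x = y
    · subst hxy; rfl
    · refine SimpleGraph.Adj.reachable ?_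
      rw [SimpleGraph.induce_adj]
      refine (hadj x y).2 ⟨hxy, f, hf, ?_⟩
      symm
      refine Finset.eq_of_subset_of_card_le (by simp [Finset.insert_subset_iff, *]) ?_
      rw [Finset.card_pair hxy]
      exact hsimple f (hFE (hCF hf)) e he fun h => heF (h ▸ hCF hf)
  have hreach : ∀ f g, Relation.ReflTransGen
      (fun a b : Finset V => a ∈ C ∧ b ∈ C ∧ (a ∩ b).Nonempty) f g →
      ∀ (hf : f ∈ C) (hg : g ∈ C) x (hx : x ∈ f ∩ e) y (hy : y ∈ g ∩ e),
      (G.induce (↑(e ∩ C.biUnion id) : Set V)).Reachable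
        ⟨x, hmem f hf x hx⟩ ⟨y, hmem g hg y hy⟩ := by
    intro f g hfg
    induction hfg with
    | refl => exact fun hf _ x hx y hy => hedge f hf x hx y hy
    | @tail g g' _ hstep ih =>
      intro hf hg' x hx y hy
      obtain ⟨hg, -, z, hz⟩ := hstep
      rw [Finset.mem_inter] at hz
      by_cases hgg : g = g'
      · subst hgg
        exact ih hf hg x hx y hy
      have hze : z ∈ e := by
        by_contra hze
        have : z ∈ (g \ e) ∩ (g' \ e) := by simp [hz, hze]
        rw [hdisj g (hCF hg) g' (hCF hg') hgg] at this
        simp at this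
      exact (ih hf hg x hx z (Finset.mem_inter.2 ⟨hz.1, hze⟩)).trans
        (hedge g' hg' z (Finset.mem_inter.2 ⟨hz.2, hze⟩) y hy)
  have hne : Nonempty (↑(e ∩ C.biUnion id) : Set V) := by
    obtain ⟨f, hf⟩ := hCne
    obtain ⟨x, hx⟩ := hint f (hCF hf)
    exact ⟨⟨x, hmem f hf x hx⟩⟩
  refine ⟨⟨?_⟩, hacyc.induce _⟩
  rintro ⟨x, hx⟩ ⟨y, hy⟩
  have hx' := hx
  have hy' := hy
  simp only [Finset.coe_inter, Set.mem_inter_iff, Finset.mem_coe, Finset.mem_biUnion, id] at hx' hy'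
  obtain ⟨hxe, f, hf, hxf⟩ := hx'
  obtain ⟨hye, g, hg, hyg⟩ := hy'
  exact hreach f g (hconn f hf g hg) hf hg x (Finset.mem_inter.2 ⟨hxf, hxe⟩) y
    (Finset.mem_inter.2 ⟨hyg, hye⟩)
end

section
/- Let k = k(n) ≥ 3 and r = r(n) ≥ 2 satisfy r^{k−1} k^{−φ(k)} ≥ 6 ln n, where φ(k) = 4·⌊√(ln k / ln(2 ln k))⌋^{−1}. If p = p(n) ≤ (1/2) · (r^{k−1}/k^{1+φ(k)}) · n/C(n,k), then P(Δ(H(n,k,p)) ≥ r^{k−1} k^{−φ(k)}) → 0 as n → ∞. -/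
open Finset Filter

open scoped Classical

/-- The number of `(k + 1)`-subsets of `Fin n` containing a given vertex. -/
theorem HG.card_filter_mem_powersetCard {n : ℕ} (k : ℕ) (v : Fin n) :
    (((univ : Finset (Fin n)).powersetCard (k + 1)).filter fun e => v ∈ e).card =
      (n - 1).choose k := by
  have h : (((univ : Finset (Fin n)).powersetCard (k + 1)).filter fun e => v ∈ e) =
      (((univ : Finset (Fin n)).erase v).powersetCard k).image (insert v) := by
    ext e
    simp only [mem_filter, mem_powersetCard, mem_image, subset_univ, true_and]
    constructor
    · rintro ⟨hc, hv⟩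
      exact ⟨e.erase v, ⟨erase_subset_erase v (subset_univ e), by
        rw [card_erase_of_mem hv, hc]; rfl⟩, insert_erase hv⟩
    · rintro ⟨f, ⟨hf, hc⟩, rfl⟩
      have hv : v ∉ f := fun hv => by simpa using hf hv
      exact ⟨by rw [card_insert_of_notMem hv, hc], mem_insert_self v f⟩
  rw [h, card_image_of_injOn, card_powersetCard, card_erase_of_mem (mem_univ v), card_univ,
    Fintype.card_fin]
  intro f hf g hg hfg
  simp only [mem_coe, mem_powersetCard] at hf hg
  have hvf : v ∉ f := fun hv => by simpa using hf.1 hv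
  have hvg : v ∉ g := fun hv => by simpa using hg.1 hv
  rw [← erase_insert hvf, ← erase_insert hvg]
  exact congrArg (fun e => e.erase v) hfg

/-- The moment generating function at `log 2` of the number of elements satisfying `q`
in a binomial random subset of `S`. -/
theorem HG.sum_powerset_two_pow_mul {α : Type*} (S : Finset α) (q : α → Prop)
    [DecidablePred q] (p : ℝ) :
    ∑ E ∈ S.powerset, (2 : ℝ) ^ (E.filter q).card *
        (p ^ E.card * (1 - p) ^ (S.card - E.card)) =
      (1 + p) ^ (S.filter q).card := by
  have h := prod_add (fun a => if q a then 2 * p else p) (fun _ => 1 - p) S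
  have hl : ∏ a ∈ S, ((if q a then 2 * p else p) + (1 - p)) = (1 + p) ^ (S.filter q).card := by
    rw [← prod_const, prod_filter]
    refine prod_congr rfl fun a _ => ?_
    split_ifs <;> ring
  rw [← hl, h]
  refine sum_congr rfl fun E hE => ?_
  have hE' : E ⊆ S := mem_powerset.1 hE
  have hp : ∏ a ∈ E, (if q a then 2 * p else p) = 2 ^ (E.filter q).card * p ^ E.card := by
    rw [← prod_const, ← prod_const, prod_filter, ← prod_mul_distrib]
    refine prod_congr rfl fun a _ => ?_
    split_ifs <;> ring
  rw [hp, prod_const, card_sdiff_of_subset hE']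
  ring

/-- A positive lower bound on the maximum degree is witnessed by a vertex. -/
theorem HG.exists_le_degree_of_le_maxDegree {V : Type*} [DecidableEq V] {E : Finset (Finset V)}
    {D : ℝ} (hD : 0 < D) (h : D ≤ (HG.maxDegree E : ℝ)) :
    ∃ v, D ≤ ((E.filter fun e => v ∈ e).card : ℝ) := by
  by_contra! hv
  have hpos : 0 < HG.maxDegree E := by exact_mod_cast hD.trans_le h
  obtain ⟨v, -, hveq⟩ := exists_mem_eq_sup (E.biUnion id)
    (nonempty_iff_ne_empty.2 fun h0 => by simp [HG.maxDegree, h0] at hpos)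
    (fun v => (E.filter fun e => v ∈ e).card)
  refine absurd (hv v) (not_lt.2 ?_)
  rw [← hveq]
  exact h

/-- Chernoff and union bound for the maximum degree when the expected degree is at most half
the threshold. -/
theorem HG.hyperProb_le_maxDegree {n k : ℕ} {p D : ℝ} (hp0 : 0 ≤ p) (hD : 0 < D)
    (hpD : p * ((n - 1).choose k : ℝ) ≤ D / 2) :
    0 ≤ HG.hyperProb n (k + 1) p (fun E => D ≤ (HG.maxDegree E : ℝ)) ∧
    HG.hyperProb n (k + 1) p (fun E => D ≤ (HG.maxDegree E : ℝ)) ≤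
      n * Real.exp (-(D * (Real.log 2 - 1 / 2))) := by
  unfold HG.hyperProb
  set S := (univ : Finset (Fin n)).powersetCard (k + 1)
  have hS : ∀ v : Fin n, (S.filter fun e => v ∈ e).card = (n - 1).choose k := fun v =>
    HG.card_filter_mem_powersetCard k v
  rcases le_or_gt p 1 with hp1 | hp1
  · have hw : ∀ E : Finset (Finset (Fin n)), 0 ≤ p ^ E.card * (1 - p) ^ (S.card - E.card) :=
      fun E => mul_nonneg (pow_nonneg hp0 _) (pow_nonneg (sub_nonneg.2 hp1) _)
    constructor
    · exact sum_nonneg fun E _ => by split_ifs <;> [exact hw E; exact le_rfl]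
    calc _ ≤ ∑ E ∈ S.powerset, ∑ v : Fin n, Real.exp (-(D * Real.log 2)) *
          ((2 : ℝ) ^ (E.filter fun e => v ∈ e).card *
            (p ^ E.card * (1 - p) ^ (S.card - E.card))) := by
          refine sum_le_sum fun E _ => ?_
          have hnn : ∀ v ∈ (univ : Finset (Fin n)), 0 ≤ Real.exp (-(D * Real.log 2)) *
              ((2 : ℝ) ^ (E.filter fun e => v ∈ e).card *
                (p ^ E.card * (1 - p) ^ (S.card - E.card))) := fun v _ =>
            mul_nonneg (Real.exp_nonneg _) (mul_nonneg (by positivity) (hw E))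
          split_ifs with h
          · obtain ⟨v, hv⟩ := HG.exists_le_degree_of_le_maxDegree hD h
            refine le_trans ?_ (single_le_sum hnn (mem_univ v))
            rw [← mul_assoc]
            refine le_mul_of_one_le_left (hw E) ?_
            rw [← Real.exp_log (two_pos (α := ℝ)), ← Real.exp_nat_mul, ← Real.exp_add,
              Real.exp_log two_pos]
            refine Real.one_le_exp ?_
            have := mul_le_mul_of_nonneg_right hv (Real.log_nonneg one_le_two)
            linarith
          · exact sum_nonneg hnn
      _ = ∑ v : Fin n, Real.exp (-(D * Real.log 2)) * (1 + p) ^ ((n - 1).choose k) := by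
          rw [sum_comm]
          refine sum_congr rfl fun v _ => ?_
          rw [← mul_sum, HG.sum_powerset_two_pow_mul, hS]
      _ = n * (Real.exp (-(D * Real.log 2)) * (1 + p) ^ ((n - 1).choose k)) := by simp
      _ ≤ n * Real.exp (-(D * (Real.log 2 - 1 / 2))) := by
          refine mul_le_mul_of_nonneg_left ?_ n.cast_nonneg
          have h1 : (1 + p) ^ ((n - 1).choose k) ≤ Real.exp (D / 2) :=
            calc (1 + p) ^ ((n - 1).choose k) ≤ Real.exp p ^ ((n - 1).choose k) :=
                  pow_le_pow_left₀ (by linarith) (by linarith [Real.add_one_le_exp p]) _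
              _ = Real.exp (p * ((n - 1).choose k : ℝ)) := by
                  rw [← Real.exp_nat_mul, mul_comm]
              _ ≤ _ := Real.exp_le_exp.2 hpD
          refine (mul_le_mul_of_nonneg_left h1 (Real.exp_nonneg _)).trans_eq ?_
          rw [← Real.exp_add]
          congr 1
          ring
  · have h0 : ∀ E ∈ S.powerset, ¬ D ≤ (HG.maxDegree E : ℝ) := fun E hE h => by
      obtain ⟨v, hv⟩ := HG.exists_le_degree_of_le_maxDegree hD h
      have h1 : ((E.filter fun e => v ∈ e).card : ℝ) ≤ ((n - 1).choose k : ℝ) := by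
        rw [← hS v]
        exact_mod_cast card_le_card (filter_subset_filter _ (mem_powerset.1 hE))
      nlinarith
    rw [sum_eq_zero fun E hE => if_neg (h0 E hE)]
    exact ⟨le_rfl, by positivity⟩

theorem HG.mul_choose_le_of_le_div_choose {n k : ℕ} (hn : 0 < n) {p A B : ℝ} (hA : 0 ≤ A)
    (hp : p ≤ 1 / 2 * (A / ((k + 1 : ℕ) * B)) * (n / (n.choose (k + 1) : ℝ))) (hB : 0 < B) :
    p * ((n - 1).choose k : ℝ) ≤ A / B / 2 := by
  obtain ⟨m, rfl⟩ : ∃ m, n = m + 1 := ⟨n - 1, by omega⟩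
  rw [Nat.add_sub_cancel]
  have hc : ((m + 1 : ℕ) : ℝ) * (m.choose k : ℝ) = ((m + 1).choose (k + 1) : ℝ) * (k + 1 : ℕ) := by
    exact_mod_cast Nat.add_one_mul_choose_eq m k
  rcases (Nat.zero_le (m.choose k)).eq_or_lt with h0 | hpos
  · rw [← h0]
    simp only [Nat.cast_zero, mul_zero]
    positivity
  have hpos' : (0 : ℝ) < m.choose k := by exact_mod_cast hpos
  have hm : (0 : ℝ) < (m + 1 : ℕ) := by positivity
  have hk : (0 : ℝ) < (k + 1 : ℕ) := by positivity
  have hC : (0 : ℝ) < ((m + 1).choose (k + 1) : ℝ) :=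
    pos_of_mul_pos_left (hc ▸ mul_pos hm hpos') hk.le
  refine (mul_le_mul_of_nonneg_right hp hpos'.le).trans_eq ?_
  rw [show 1 / 2 * (A / ((k + 1 : ℕ) * B)) * ((m + 1 : ℕ) / ((m + 1).choose (k + 1) : ℝ)) *
      (m.choose k : ℝ) = 1 / 2 * (A / ((k + 1 : ℕ) * B)) *
      (((m + 1 : ℕ) * (m.choose k : ℝ)) / ((m + 1).choose (k + 1) : ℝ)) by ring, hc]
  field_simp

/-- Let `k = k(n) ≥ 3` and `r = r(n) ≥ 2` satisfy
`r^(k−1) k^(−φ(k)) ≥ 6 ln n`. If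
`p = p(n) ≤ (1/2)(r^(k−1)/k^(1+φ(k))) n / C(n,k)`, then
`P(Δ(H(n,k,p)) ≥ r^(k−1) k^(−φ(k))) → 0` as `n → ∞`. -/
theorem stmt11 (k r : ℕ → ℕ) (p : ℕ → ℝ)
    (hk : ∀ n, 3 ≤ k n) (hr : ∀ n, 2 ≤ r n)
    (hlog : ∀ n : ℕ, 6 * Real.log n ≤
      (r n : ℝ) ^ (k n - 1) * (k n : ℝ) ^ (-HG.phi (k n)))
    (hp0 : ∀ n, 0 ≤ p n)
    (hp : ∀ n, p n ≤ (1 / 2 : ℝ) *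
        ((r n : ℝ) ^ (k n - 1) / (k n : ℝ) ^ ((1 : ℝ) + HG.phi (k n))) *
        ((n : ℝ) / (n.choose (k n) : ℝ))) :
    Tendsto (fun n => HG.hyperProb n (k n) (p n) (fun E =>
        (r n : ℝ) ^ (k n - 1) * (k n : ℝ) ^ (-HG.phi (k n)) ≤ (HG.maxDegree E : ℝ)))
      atTop (nhds 0) := by
  have hD : ∀ n, 0 < (r n : ℝ) ^ (k n - 1) * (k n : ℝ) ^ (-HG.phi (k n)) := fun n => by
    have h1 : (0 : ℝ) < r n := by exact_mod_cast two_pos.trans_le (hr n)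
    have h2 : (0 : ℝ) < k n := by exact_mod_cast (Nat.succ_pos 2).trans_le (hk n)
    exact mul_pos (pow_pos h1 _) (Real.rpow_pos_of_pos h2 _)
  have hbound : ∀ n, 0 < n →
      0 ≤ HG.hyperProb n (k n) (p n) (fun E =>
        (r n : ℝ) ^ (k n - 1) * (k n : ℝ) ^ (-HG.phi (k n)) ≤ (HG.maxDegree E : ℝ)) ∧
      HG.hyperProb n (k n) (p n) (fun E =>
        (r n : ℝ) ^ (k n - 1) * (k n : ℝ) ^ (-HG.phi (k n)) ≤ (HG.maxDegree E : ℝ)) ≤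
        (n : ℝ) ^ (-(1 / 10 : ℝ)) := by
    intro n hn
    have hDn := hD n
    have hln := hlog n
    have hpn := hp n
    obtain ⟨j, hj⟩ : ∃ j, k n = j + 1 := ⟨k n - 1, by have := hk n; omega⟩
    rw [hj] at hDn hln hpn ⊢
    rw [Nat.add_sub_cancel] at hDn hln hpn ⊢
    have hkpos : (0 : ℝ) < ((j + 1 : ℕ) : ℝ) := by positivity
    have hn' : (0 : ℝ) < n := by exact_mod_cast hn
    rw [Real.rpow_add hkpos, Real.rpow_one] at hpn
    have hpD := HG.mul_choose_le_of_le_div_choose hn (by positivity) hpn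
      (Real.rpow_pos_of_pos hkpos _)
    rw [div_eq_mul_inv ((r n : ℝ) ^ j), ← Real.rpow_neg hkpos.le] at hpD
    obtain ⟨h0, h1⟩ := HG.hyperProb_le_maxDegree (hp0 n) hDn hpD
    refine ⟨h0, h1.trans ?_⟩
    rw [Real.rpow_def_of_pos hn']
    nth_rewrite 1 [← Real.exp_log hn']
    rw [← Real.exp_add, Real.exp_le_exp]
    have hl := Real.log_two_gt_d9
    have hl0 : 0 ≤ Real.log n := Real.log_natCast_nonneg n
    nlinarith
  refine tendsto_of_tendsto_of_tendsto_of_le_of_le' tendsto_const_nhds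
    ((tendsto_rpow_neg_atTop (by norm_num : (0 : ℝ) < 1 / 10)).comp
      tendsto_natCast_atTop_atTop) ?_ ?_
  · filter_upwards [eventually_gt_atTop 0] with n hn using (hbound n hn).1
  · filter_upwards [eventually_gt_atTop 0] with n hn using (hbound n hn).2
end
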